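/- Let f(z) = (1/2)e^{−|z|} be the standard Laplace density, G₀ a probability measure on ℝ, and p₀ = p_{G₀}, where p_G(x) = ∫ f(x−y) dG(y). Let X₁, …, Xₙ be i.i.d. with density p₀ (joint law P₀ⁿ). Suppose there is a sequence σₙ ≥ 0 with σₙ = O(n^{−3/8} log^{1/8} n) such that ∫_{p₀ ≤ σₙ} p₀ dλ ≲ σₙ² and ∫_{p₀ > σₙ} (1/p₀) dλ ≲ log(1/σₙ). Let Ĝₙ be a maximum likelihood estimator of the mixing distribution, i.e. a measurable function of (X₁,…,Xₙ) with values in the probability measures on ℝ satisfying ∑_{i=1}^n log p_{Ĝₙ}(X_i) ≥ ∑_{i=1}^n log p_G(X_i) for every probability measure G. Suppose in addition that G₀ has finite moment generating function M_{G₀}(s) on some interval (−s₀, s₀) with 0 < s₀ < 1, and that for every 0 < s < s₀, limsup_{n→+∞} E_{P₀ⁿ}[M_{Ĝₙ}(−s)] ≤ M_{G₀}(−s) and limsup_{n→+∞} E_{P₀ⁿ}[M_{Ĝₙ}(s)] ≤ M_{G₀}(s). Then W₁(Ĝₙ, G₀) = O_P(n^{−1/8} (log n)^{13/24}), i.e.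 lim_{T→+∞} limsup_{n→+∞} P₀ⁿ( W₁(Ĝₙ, G₀) > T n^{−1/8}(log n)^{13/24} ) = 0. -/

import Mathlib

open MeasureTheory Filter Real Topology

/-- The standard Laplace density `f(z) = (1/2) e^{−|z|}`. -/
noncomputable def laplaceDens (z : ℝ) : ℝ := (1 / 2) * Real.exp (-|z|)

/-- Mixture density `p_G(x) = ∫ f(x−y) dG(y)`. -/
noncomputable def mixDens (f : ℝ → ℝ) (G : Measure ℝ) (x : ℝ) : ℝ :=
  ∫ y, f (x - y) ∂G

/-- Moment generating function `M_G(s) = ∫ e^{sy} dG(y)`. -/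
noncomputable def mgfOf (G : Measure ℝ) (s : ℝ) : ℝ :=
  ∫ y, Real.exp (s * y) ∂G

/-- `L^p`-Wasserstein distance: infimum over couplings of
`(∫ |y₁−y₂|^p dγ)^{1/p}`. -/
noncomputable def wassersteinDist (p : ℝ) (G G' : Measure ℝ) : ℝ :=
  sInf {c : ℝ | ∃ γ : Measure (ℝ × ℝ), IsProbabilityMeasure γ ∧
    γ.map Prod.fst = G ∧ γ.map Prod.snd = G' ∧
    c = (∫ z : ℝ × ℝ, |z.1 - z.2| ^ p ∂γ) ^ (1 / p)}

/-- The joint law `P₀ⁿ` of `n` i.i.d. observations from the density `p₀`. -/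
noncomputable def jointLaw (p₀ : ℝ → ℝ) (n : ℕ) : Measure (Fin n → ℝ) :=
  Measure.pi fun _ => volume.withDensity fun x => ENNReal.ofReal (p₀ x)

/-- The rate `n^{−3/8} (log n)^{1/8}`. -/
noncomputable def mleRate (n : ℕ) : ℝ :=
  (n : ℝ) ^ (-(3 : ℝ) / 8) * Real.log n ^ ((1 : ℝ) / 8)

/-- The rate `n^{−1/8} (log n)^{13/24}`. -/
noncomputable def wassRate (n : ℕ) : ℝ :=
  (n : ℝ) ^ (-(1 : ℝ) / 8) * Real.log n ^ ((13 : ℝ) / 24)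


/-! ### Quantile coupling -/

/-- Quantile function. -/
noncomputable def qFun (μ : Measure ℝ) (u : ℝ) : ℝ := sInf {x | u ≤ ProbabilityTheory.cdf μ x}

lemma qFun_le_iff (μ : Measure ℝ) {u : ℝ} (hu : u ∈ Set.Ioo (0:ℝ) 1) (x : ℝ) :
    qFun μ u ≤ x ↔ u ≤ ProbabilityTheory.cdf μ x := by
  have hbdd : BddBelow {x | u ≤ ProbabilityTheory.cdf μ x} := by
    have h := (ProbabilityTheory.tendsto_cdf_atBot μ).eventually (gt_mem_nhds hu.1)
    obtain ⟨a, ha⟩ := h.exists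
    refine ⟨a, fun y hy => ?_⟩
    by_contra hlt
    push Not at hlt
    have := ProbabilityTheory.monotone_cdf μ hlt.le
    simp only [Set.mem_ofPred_eq] at hy
    linarith
  have hne : {x | u ≤ ProbabilityTheory.cdf μ x}.Nonempty := by
    have h := (ProbabilityTheory.tendsto_cdf_atTop μ).eventually (lt_mem_nhds hu.2)
    obtain ⟨a, ha⟩ := h.exists
    exact ⟨a, ha.le⟩
  constructor
  · intro h
    have key : ∀ y, x < y → u ≤ ProbabilityTheory.cdf μ y := by
      intro y hy
      obtain ⟨z, hz, hzy⟩ := exists_lt_of_csInf_lt hne (lt_of_le_of_lt h hy)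
      exact le_trans hz (ProbabilityTheory.monotone_cdf μ hzy.le)
    have hc : Tendsto (ProbabilityTheory.cdf μ) (𝓝[>] x) (𝓝 (ProbabilityTheory.cdf μ x)) :=
      ((ProbabilityTheory.cdf μ).right_continuous x).mono_left
        (nhdsWithin_mono _ Set.Ioi_subset_Ici_self)
    refine ge_of_tendsto hc ?_
    filter_upwards [self_mem_nhdsWithin] with y hy using key y hy
  · intro h
    exact csInf_le hbdd h

lemma qFun_aemeas (μ : Measure ℝ) :
    AEMeasurable (qFun μ) (volume.restrict (Set.Ioo (0:ℝ) 1)) := by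
  apply aemeasurable_restrict_of_monotoneOn measurableSet_Ioo
  intro u hu v hv huv
  rw [qFun_le_iff μ hu]
  exact huv.trans ((qFun_le_iff μ hv _).1 le_rfl)

lemma qFun_map (μ : Measure ℝ) [IsProbabilityMeasure μ] :
    (volume.restrict (Set.Ioo (0:ℝ) 1)).map (qFun μ) = μ := by
  have : IsFiniteMeasure ((volume.restrict (Set.Ioo (0:ℝ) 1)).map (qFun μ)) := by infer_instance
  apply Measure.ext_of_Iic
  intro a
  rw [Measure.map_apply_of_aemeasurable (qFun_aemeas μ) measurableSet_Iic,
    Measure.restrict_apply' measurableSet_Ioo, ← ProbabilityTheory.ofReal_cdf]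
  have h0 := ProbabilityTheory.cdf_nonneg μ a
  have h1 := ProbabilityTheory.cdf_le_one μ a
  have hset : qFun μ ⁻¹' Set.Iic a ∩ Set.Ioo 0 1
      = Set.Iic (ProbabilityTheory.cdf μ a) ∩ Set.Ioo 0 1 := by
    ext u
    simp only [Set.mem_inter_iff, Set.mem_preimage, Set.mem_Iic]
    constructor
    · rintro ⟨h, hu⟩; exact ⟨(qFun_le_iff μ hu a).1 h, hu⟩
    · rintro ⟨h, hu⟩; exact ⟨(qFun_le_iff μ hu a).2 h, hu⟩
  rw [hset]
  apply le_antisymm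
  · calc _ ≤ volume (Set.Ioc 0 (ProbabilityTheory.cdf μ a)) :=
          measure_mono (fun u hu => ⟨hu.2.1, hu.1⟩)
      _ = _ := by simp
  · calc ENNReal.ofReal (ProbabilityTheory.cdf μ a)
          = volume (Set.Ioo 0 (ProbabilityTheory.cdf μ a)) := by simp
      _ ≤ volume (Set.Iic (ProbabilityTheory.cdf μ a) ∩ Set.Ioo 0 1) :=
          measure_mono (fun u hu => ⟨hu.2.le, hu.1, hu.2.trans_le h1⟩)

/-- Kolmogorov-type `L¹` distance of distribution functions. -/
noncomputable def cdfDist (μ ν : Measure ℝ) : ENNReal :=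
  ∫⁻ x, ENNReal.ofReal |ProbabilityTheory.cdf μ x - ProbabilityTheory.cdf ν x|

lemma exists_coupling (μ ν : Measure ℝ) [IsProbabilityMeasure μ] [IsProbabilityMeasure ν] :
    ∃ γ : Measure (ℝ × ℝ), IsProbabilityMeasure γ ∧ γ.map Prod.fst = μ ∧ γ.map Prod.snd = ν ∧
      ∫⁻ z, ENNReal.ofReal |z.1 - z.2| ∂γ ≤ cdfDist μ ν := by
  set l : Measure ℝ := volume.restrict (Set.Ioo (0:ℝ) 1) with hl
  have hlp : IsProbabilityMeasure l := ⟨by simp [hl]⟩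
  have hm : AEMeasurable (fun u => (qFun μ u, qFun ν u)) l :=
    (qFun_aemeas μ).prodMk (qFun_aemeas ν)
  refine ⟨l.map (fun u => (qFun μ u, qFun ν u)), Measure.isProbabilityMeasure_map hm, ?_, ?_, ?_⟩
  · rw [AEMeasurable.map_map_of_aemeasurable measurable_fst.aemeasurable hm]
    exact qFun_map μ
  · rw [AEMeasurable.map_map_of_aemeasurable measurable_snd.aemeasurable hm]
    exact qFun_map ν
  · rw [lintegral_map' (by fun_prop) hm]
    set F := fun x => ProbabilityTheory.cdf μ x with hF
    set H := fun x => ProbabilityTheory.cdf ν x with hH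
    have hFm : Measurable F := (ProbabilityTheory.monotone_cdf μ).measurable
    have hHm : Measurable H := (ProbabilityTheory.monotone_cdf ν).measurable
    set A : Set (ℝ × ℝ) := {p | min (F p.2) (H p.2) < p.1 ∧ p.1 ≤ max (F p.2) (H p.2)} with hA
    have hAm : MeasurableSet A := by
      apply MeasurableSet.inter
      · exact measurableSet_lt (f := fun p : ℝ × ℝ => min (F p.2) (H p.2)) (g := fun p => p.1)
          (by fun_prop) (by fun_prop)
      · exact measurableSet_le (f := fun p : ℝ × ℝ => p.1) (g := fun p => max (F p.2) (H p.2))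
          (by fun_prop) (by fun_prop)
    calc ∫⁻ u, ENNReal.ofReal |qFun μ u - qFun ν u| ∂l
        ≤ ∫⁻ u, ∫⁻ x, A.indicator 1 (u, x) ∂volume ∂l := by
          rw [hl]
          apply setLIntegral_mono_ae' measurableSet_Ioo
          refine Eventually.of_forall fun u hu => ?_
          have : (fun x => A.indicator (1 : ℝ × ℝ → ENNReal) (u, x))
              = (Set.Ico (min (qFun μ u) (qFun ν u)) (max (qFun μ u) (qFun ν u))).indicator 1 := by
            ext x
            simp only [Set.indicator]
            congr 1
            simp only [hA, Set.mem_ofPred_eq, Set.mem_Ico, eq_iff_iff, min_le_iff, max_le_iff, le_min_iff,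
              le_max_iff, qFun_le_iff _ hu, ← not_le, hF, hH]
            tauto
          rw [this, lintegral_indicator_one measurableSet_Ico, Real.volume_Ico, max_sub_min_eq_abs']
      _ = ∫⁻ x, ∫⁻ u, A.indicator 1 (u, x) ∂l ∂volume := by
          apply lintegral_lintegral_swap
          exact (measurable_one.indicator hAm).aemeasurable
      _ ≤ ∫⁻ x, ENNReal.ofReal |F x - H x| := by
          apply lintegral_mono
          intro x
          calc ∫⁻ u, A.indicator 1 (u, x) ∂l ≤ ∫⁻ u, A.indicator 1 (u, x) ∂volume :=
                lintegral_mono' Measure.restrict_le_self le_rfl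
            _ = ∫⁻ u, (Set.Ioc (min (F x) (H x)) (max (F x) (H x))).indicator 1 u := by
                apply lintegral_congr; intro u; simp [Set.indicator, hA]
            _ = _ := by
                rw [lintegral_indicator_one measurableSet_Ioc, Real.volume_Ioc,
                  max_sub_min_eq_abs']


lemma wass_le (μ ν : Measure ℝ) [IsProbabilityMeasure μ] [IsProbabilityMeasure ν]
    (h : cdfDist μ ν ≠ ⊤) : wassersteinDist 1 μ ν ≤ (cdfDist μ ν).toReal := by
  obtain ⟨γ, hγ, h1, h2, hc⟩ := exists_coupling μ ν
  have hmem : ∫ z : ℝ × ℝ, |z.1 - z.2| ∂γ ≤ (cdfDist μ ν).toReal := by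
    rw [integral_eq_lintegral_of_nonneg_ae (Eventually.of_forall fun z => abs_nonneg _)
      (by fun_prop)]
    exact ENNReal.toReal_mono h hc
  refine le_trans (csInf_le ⟨0, ?_⟩ ⟨γ, hγ, h1, h2, rfl⟩) ?_
  · rintro c ⟨γ', _, _, _, rfl⟩
    apply Real.rpow_nonneg
    apply integral_nonneg
    intro z
    positivity
  · simpa using hmem

lemma lip_bound (μ ν : Measure ℝ) [IsProbabilityMeasure μ] [IsProbabilityMeasure ν]
    (h : cdfDist μ ν ≠ ⊤) (g : ℝ → ℝ) (hg : ∀ x y, |g x - g y| ≤ 2 * |x - y|)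
    (hμ : Integrable g μ) (hν : Integrable g ν) :
    ∫ x, g x ∂μ - ∫ x, g x ∂ν ≤ 2 * (cdfDist μ ν).toReal := by
  obtain ⟨γ, hγ, h1, h2, hc⟩ := exists_coupling μ ν
  have hfin : ∫⁻ z : ℝ × ℝ, ENNReal.ofReal |z.1 - z.2| ∂γ < ⊤ := lt_of_le_of_lt hc h.lt_top
  have hi : Integrable (fun z : ℝ × ℝ => |z.1 - z.2|) γ := by
    refine ⟨by fun_prop, ?_⟩
    rw [hasFiniteIntegral_iff_ofReal (Eventually.of_forall fun z => abs_nonneg _)]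
    exact hfin
  have hmem : ∫ z : ℝ × ℝ, |z.1 - z.2| ∂γ ≤ (cdfDist μ ν).toReal := by
    rw [integral_eq_lintegral_of_nonneg_ae (Eventually.of_forall fun z => abs_nonneg _)
      (by fun_prop)]
    exact ENNReal.toReal_mono h hc
  have e1 : ∫ x, g x ∂μ = ∫ z, g z.1 ∂γ := by
    rw [← h1, integral_map measurable_fst.aemeasurable (by rw [h1]; exact hμ.1)]
  have e2 : ∫ x, g x ∂ν = ∫ z, g z.2 ∂γ := by
    rw [← h2, integral_map measurable_snd.aemeasurable (by rw [h2]; exact hν.1)]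
  have i1 : Integrable (fun z : ℝ × ℝ => g z.1) γ := by
    rw [← h1] at hμ; exact hμ.comp_measurable measurable_fst
  have i2 : Integrable (fun z : ℝ × ℝ => g z.2) γ := by
    rw [← h2] at hν; exact hν.comp_measurable measurable_snd
  rw [e1, e2, ← integral_sub i1 i2]
  calc _ ≤ ∫ z : ℝ × ℝ, 2 * |z.1 - z.2| ∂γ :=
        integral_mono (i1.sub i2) (hi.const_mul 2)
          (fun z => (le_abs_self _).trans (hg z.1 z.2))
    _ = 2 * ∫ z : ℝ × ℝ, |z.1 - z.2| ∂γ := integral_const_mul _ _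
    _ ≤ _ := by linarith

/-! ### Laplace density -/

lemma lap_pos (z : ℝ) : 0 < laplaceDens z := by unfold laplaceDens; positivity

lemma lap_le (z : ℝ) : laplaceDens z ≤ 1 := by
  unfold laplaceDens
  have : Real.exp (-|z|) ≤ 1 := Real.exp_le_one_iff.2 (by simp)
  linarith

lemma lap_cont : Continuous laplaceDens := by unfold laplaceDens; fun_prop

lemma exp_abs_integrable {c : ℝ} (hc : 0 < c) : Integrable (fun x : ℝ => Real.exp (-(c * |x|))) := by
  rw [← integrableOn_univ, ← Set.Iic_union_Ioi (a := (0:ℝ))]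
  apply IntegrableOn.union
  · refine (integrableOn_exp_mul_Iic hc 0).congr_fun (fun x hx => ?_) measurableSet_Iic
    simp only [Set.mem_Iic] at hx
    simp [abs_of_nonpos hx]
  · refine (integrableOn_exp_mul_Ioi (neg_lt_zero.2 hc) 0).congr_fun (fun x hx => ?_) measurableSet_Ioi
    simp only [Set.mem_Ioi] at hx
    simp [abs_of_pos hx]

lemma lap_integrable : Integrable laplaceDens := by
  have := (exp_abs_integrable one_pos).const_mul (1/2)
  refine this.congr (Eventually.of_forall fun z => ?_)
  simp [laplaceDens]

lemma lap_integral : ∫ z, laplaceDens z = 1 := by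
  unfold laplaceDens
  rw [integral_const_mul, integral_comp_abs (f := fun x => Real.exp (-x)),
    integral_exp_neg_Ioi_zero]
  norm_num

lemma lap_neg (z : ℝ) : laplaceDens (-z) = laplaceDens z := by simp [laplaceDens]

lemma id_lap_integrable : Integrable (fun z => z * laplaceDens z) := by
  have h := (exp_abs_integrable (c := 1/2) (by norm_num)).const_mul 1
  refine h.mono' (continuous_id.mul lap_cont).aestronglyMeasurable (Eventually.of_forall fun z => ?_)
  unfold laplaceDens
  rw [Real.norm_eq_abs, abs_mul, abs_of_pos (by positivity : 0 < (1:ℝ)/2 * Real.exp (-|z|))]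
  have h1 : |z| / 2 ≤ Real.exp (1/2 * |z|) := by
    have := Real.add_one_le_exp (1/2 * |z|); linarith
  have h2 : Real.exp (-|z|) = Real.exp (-(1/2*|z|)) * Real.exp (-(1/2 * |z|)) := by
    rw [← Real.exp_add]; ring_nf
  have h3 : Real.exp (1/2 * |z|) * Real.exp (-(1/2*|z|)) = 1 := by
    rw [← Real.exp_add]; simp
  have h4 := Real.exp_pos (-(1/2*|z|))
  calc |z| * (1/2 * Real.exp (-|z|)) = (|z|/2 * Real.exp (-(1/2*|z|))) * Real.exp (-(1/2*|z|)) := by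
        rw [h2]; ring
    _ ≤ (Real.exp (1/2 * |z|) * Real.exp (-(1/2*|z|))) * Real.exp (-(1/2*|z|)) := by gcongr
    _ = _ := by rw [h3]

lemma hinge_integrable (a : ℝ) : Integrable (fun z => max (a - z) 0 * laplaceDens z) := by
  have h : Integrable (fun z => |a| * laplaceDens z + |z * laplaceDens z|) :=
    (lap_integrable.const_mul |a|).add id_lap_integrable.abs
  refine h.mono' (Continuous.aestronglyMeasurable
    ((by fun_prop : Continuous fun z : ℝ => max (a - z) 0).mul lap_cont))
    (Eventually.of_forall fun z => ?_)
  rw [Real.norm_eq_abs, abs_mul, abs_of_pos (lap_pos z), abs_mul, abs_of_pos (lap_pos z),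
    abs_of_nonneg (le_max_right _ _), ← add_mul]
  apply mul_le_mul_of_nonneg_right _ (lap_pos z).le
  apply max_le _ (by positivity)
  have := le_abs_self a
  have := neg_abs_le z
  linarith

lemma hinge_nonpos {a : ℝ} (ha : a ≤ 0) : ∫ z, max (a - z) 0 * laplaceDens z = laplaceDens a := by
  have h0 : ∫ z, max (a - z) 0 * laplaceDens z
      = ∫ z in Set.Iic a, max (a - z) 0 * laplaceDens z := by
    symm
    apply setIntegral_eq_integral_of_forall_compl_eq_zero
    intro z hz
    simp only [Set.mem_Iic, not_le] at hz
    rw [max_eq_right (by linarith), zero_mul]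
  have h1 : ∫ z in Set.Iic a, max (a - z) 0 * laplaceDens z
      = ∫ z in Set.Iic a, (a - z) * ((1/2) * Real.exp z) := by
    apply setIntegral_congr_fun measurableSet_Iic
    intro z hz
    simp only [Set.mem_Iic] at hz
    simp only [laplaceDens]
    rw [max_eq_left (by linarith), abs_of_nonpos (by linarith), neg_neg]
  have hint : IntegrableOn (fun z => (a - z) * ((1/2) * Real.exp z)) (Set.Iic a) := by
    refine (hinge_integrable a).integrableOn.congr_fun ?_ measurableSet_Iic
    intro z hz
    simp only [Set.mem_Iic] at hz
    simp only [laplaceDens]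
    rw [max_eq_left (by linarith), abs_of_nonpos (by linarith), neg_neg]
  have ht : Tendsto (fun z : ℝ => 1/2 * (a - z + 1) * Real.exp z) atBot (𝓝 0) := by
    have t1 : Tendsto (fun z : ℝ => z * Real.exp z) atBot (𝓝 0) := by
      have := (Real.tendsto_pow_mul_exp_neg_atTop_nhds_zero 1).comp tendsto_neg_atBot_atTop
      have := this.neg
      simpa [Function.comp_def] using this
    have t2 := ((Real.tendsto_exp_atBot).const_mul (1/2 * (a+1))).sub (t1.const_mul (1/2))
    simp only [mul_zero, sub_zero] at t2
    refine t2.congr fun z => ?_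
    ring
  rw [h0, h1, integral_Iic_of_hasDerivAt_of_tendsto (f := fun z => 1/2 * (a - z + 1) * Real.exp z)
    (m := 0) (by fun_prop) ?_ hint ht]
  · simp only [laplaceDens, abs_of_nonpos ha]; simp
  · intro z _
    have d1 : HasDerivAt (fun z : ℝ => 1/2 * (a - z + 1)) (1/2 * (-1)) z :=
      (((hasDerivAt_id z).const_sub a).add_const 1).const_mul (1/2)
    have d2 := d1.mul (Real.hasDerivAt_exp z)
    have e : (a - z) * ((1/2) * Real.exp z)
        = 1/2 * (-1) * Real.exp z + 1/2 * (a - z + 1) * Real.exp z := by ring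
    rw [e]
    exact d2

lemma id_lap_integral : ∫ z, z * laplaceDens z = 0 := by
  have := integral_neg_eq_self (fun z => z * laplaceDens z) volume
  simp only [lap_neg, neg_mul, integral_neg] at this
  linarith

lemma hinge_integral (a : ℝ) : ∫ z, max (a - z) 0 * laplaceDens z = max a 0 + laplaceDens a := by
  rcases le_total a 0 with ha | ha
  · rw [hinge_nonpos ha, max_eq_right ha, zero_add]
  · have h1 : ∫ z, max (-a - z) 0 * laplaceDens z = laplaceDens a := by
      rw [hinge_nonpos (by linarith), lap_neg]
    have h2 : ∫ z, max (z - a) 0 * laplaceDens z = laplaceDens a := by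
      rw [← h1, ← integral_neg_eq_self (fun z => max (-a - z) 0 * laplaceDens z) volume]
      congr 1; ext z; rw [lap_neg]; congr 2; ring
    have i2 : Integrable (fun z => max (z - a) 0 * laplaceDens z) := by
      have := (hinge_integrable (-a)).comp_neg
      refine this.congr (Eventually.of_forall fun z => ?_)
      simp only [lap_neg]; congr 2; ring
    have h3 : ∀ z, max (a - z) 0 * laplaceDens z
        = (a * laplaceDens z - z * laplaceDens z) + max (z - a) 0 * laplaceDens z := by
      intro z
      rcases le_total z a with h | h
      · rw [max_eq_left (by linarith), max_eq_right (by linarith)]; ring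
      · rw [max_eq_right (by linarith), max_eq_left (by linarith)]; ring
    simp_rw [h3]
    have i1 := lap_integrable.const_mul a
    have i3 : Integrable (fun z => a * laplaceDens z - z * laplaceDens z) :=
      i1.sub id_lap_integrable
    rw [integral_add i3 i2, integral_sub i1 id_lap_integrable,
      integral_const_mul, lap_integral, id_lap_integral, h2, max_eq_left ha]
    ring

lemma hinge_shift (b y : ℝ) : Integrable (fun z => max (b - z) 0 * laplaceDens (z - y)) ∧
    ∫ z, max (b - z) 0 * laplaceDens (z - y) = max (b - y) 0 + laplaceDens (b - y) := by
  have e : (fun z => max (b - z) 0 * laplaceDens (z - y))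
      = fun z => (fun w => max ((b - y) - w) 0 * laplaceDens w) (z - y) := by
    ext z; simp
  rw [e]
  refine ⟨(hinge_integrable (b - y)).comp_sub_right y, ?_⟩
  rw [integral_sub_right_eq_self (fun w => max ((b - y) - w) 0 * laplaceDens w) y, hinge_integral]


/-! ### Mixtures -/

lemma mix_fiber_int (G : Measure ℝ) [IsProbabilityMeasure G] (x : ℝ) :
    Integrable (fun y => laplaceDens (x - y)) G := by
  refine Integrable.of_bound (C := 1) ?_ (Eventually.of_forall fun y => ?_)
  · exact (lap_cont.comp (by fun_prop)).aestronglyMeasurable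
  · rw [Real.norm_eq_abs, abs_of_pos (lap_pos _)]; exact lap_le _

lemma mix_pos (G : Measure ℝ) [IsProbabilityMeasure G] (x : ℝ) : 0 < mixDens laplaceDens G x := by
  unfold mixDens
  rw [integral_pos_iff_support_of_nonneg (fun y => (lap_pos _).le) (mix_fiber_int G x)]
  have : Function.support (fun y => laplaceDens (x - y)) = Set.univ := by
    ext y; simp [(lap_pos (x - y)).ne']
  rw [this]; simp

lemma lap_shift (x x' y : ℝ) : laplaceDens (x - y) ≤ Real.exp |x - x'| * laplaceDens (x' - y) := by
  unfold laplaceDens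
  have : Real.exp (-|x - y|) ≤ Real.exp |x - x'| * Real.exp (-|x' - y|) := by
    rw [← Real.exp_add]
    apply Real.exp_le_exp.2
    have := abs_sub_abs_le_abs_sub (x' - y) (x - y)
    have h : x' - y - (x - y) = -(x - x') := by ring
    rw [h, abs_neg] at this
    linarith
  linarith

lemma mix_shift (G : Measure ℝ) [IsProbabilityMeasure G] (x x' : ℝ) :
    mixDens laplaceDens G x ≤ Real.exp |x - x'| * mixDens laplaceDens G x' := by
  unfold mixDens
  rw [← integral_const_mul]
  exact integral_mono (mix_fiber_int G x) ((mix_fiber_int G x').const_mul _)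
    (fun y => lap_shift x x' y)

lemma log_mix_lip (G : Measure ℝ) [IsProbabilityMeasure G] (x x' : ℝ) :
    |Real.log (mixDens laplaceDens G x) - Real.log (mixDens laplaceDens G x')| ≤ |x - x'| := by
  have key : ∀ a b : ℝ, Real.log (mixDens laplaceDens G a) - Real.log (mixDens laplaceDens G b)
      ≤ |a - b| := by
    intro a b
    have h := Real.log_le_log (mix_pos G a) (mix_shift G a b)
    rw [Real.log_mul (Real.exp_pos _).ne' (mix_pos G b).ne', Real.log_exp] at h
    linarith
  rw [abs_le]
  constructor
  · have := key x' x
    rw [abs_sub_comm] at this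
    linarith
  · exact key x x'

lemma log_mix_cont (G : Measure ℝ) [IsProbabilityMeasure G] :
    Continuous (fun x => Real.log (mixDens laplaceDens G x)) := by
  have : LipschitzWith 1 (fun x => Real.log (mixDens laplaceDens G x)) :=
    LipschitzWith.of_dist_le_mul (fun x y => by
      simpa [Real.dist_eq] using log_mix_lip G x y)
  exact this.continuous

lemma mix_cont (G : Measure ℝ) [IsProbabilityMeasure G] :
    Continuous (mixDens laplaceDens G) := by
  have h := Real.continuous_exp.comp (log_mix_cont G)
  refine h.congr fun x => ?_
  simp [Real.exp_log (mix_pos G x)]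

lemma prod_meas (k : ℝ → ℝ) (hk : Continuous k) (G : Measure ℝ) :
    AEStronglyMeasurable (fun p : ℝ × ℝ => k p.1 * laplaceDens (p.1 - p.2)) (volume.prod G) :=
  Continuous.aestronglyMeasurable
    ((hk.comp continuous_fst).mul (lap_cont.comp (by fun_prop)))

lemma prod_int (G : Measure ℝ) [IsProbabilityMeasure G] (k : ℝ → ℝ) (hk : Continuous k) (C : ℝ)
    (hC : ∀ z, |k z| ≤ C) :
    Integrable (fun p : ℝ × ℝ => k p.1 * laplaceDens (p.1 - p.2)) (volume.prod G) := by
  have h1 : Integrable (fun p : ℝ × ℝ => laplaceDens (p.1 - p.2)) (volume.prod G) := by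
    have hm : AEStronglyMeasurable (fun p : ℝ × ℝ => laplaceDens (p.1 - p.2)) (volume.prod G) :=
      Continuous.aestronglyMeasurable (lap_cont.comp (by fun_prop))
    rw [integrable_prod_iff' hm]
    refine ⟨Eventually.of_forall fun y => lap_integrable.comp_sub_right y, ?_⟩
    have : (fun y => ∫ x, ‖laplaceDens (x - y)‖) = fun _ => (1:ℝ) := by
      ext y
      rw [integral_sub_right_eq_self (fun w => ‖laplaceDens w‖) y, ← lap_integral]
      congr 1; ext z; rw [Real.norm_eq_abs, abs_of_pos (lap_pos z)]
    simp only [this]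
    exact integrable_const _
  refine (h1.const_mul C).mono' (prod_meas k hk G) (Eventually.of_forall fun p => ?_)
  rw [Real.norm_eq_abs, abs_mul, abs_of_pos (lap_pos _)]
  exact mul_le_mul_of_nonneg_right (hC _) (lap_pos _).le

lemma mix_mul_eq (G : Measure ℝ) (k : ℝ → ℝ) (z : ℝ) :
    k z * mixDens laplaceDens G z = ∫ y, k z * laplaceDens (z - y) ∂G := by
  unfold mixDens
  rw [integral_const_mul]

lemma mix_mul_integrable (G : Measure ℝ) [IsProbabilityMeasure G] (k : ℝ → ℝ) (hk : Continuous k)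
    (C : ℝ) (hC : ∀ z, |k z| ≤ C) : Integrable (fun z => k z * mixDens laplaceDens G z) := by
  simp_rw [mix_mul_eq]
  exact (prod_int G k hk C hC).integral_prod_left

lemma mix_mul_integral (G : Measure ℝ) [IsProbabilityMeasure G] (k : ℝ → ℝ) (hk : Continuous k)
    (C : ℝ) (hC : ∀ z, |k z| ≤ C) :
    ∫ z, k z * mixDens laplaceDens G z = ∫ y, (∫ z, k z * laplaceDens (z - y)) ∂G := by
  simp_rw [mix_mul_eq]
  exact integral_integral_swap (f := fun z y => k z * laplaceDens (z - y)) (prod_int G k hk C hC)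

lemma mix_integrable (G : Measure ℝ) [IsProbabilityMeasure G] :
    Integrable (mixDens laplaceDens G) := by
  simpa using mix_mul_integrable G (fun _ => 1) continuous_const 1 (by simp)

lemma mix_integral (G : Measure ℝ) [IsProbabilityMeasure G] :
    ∫ z, mixDens laplaceDens G z = 1 := by
  have h := mix_mul_integral G (fun _ => 1) continuous_const 1 (by simp)
  simp only [one_mul] at h
  rw [h]
  have : ∀ y, ∫ z, laplaceDens (z - y) = 1 := fun y => by
    rw [integral_sub_right_eq_self laplaceDens y, lap_integral]
  simp [this]

/-- The ramp kernel. -/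
noncomputable def ramp (a b z : ℝ) : ℝ := max (b - z) 0 - max (a - z) 0

lemma ramp_cont (a b : ℝ) : Continuous (ramp a b) := by unfold ramp; fun_prop

lemma ramp_nonneg {a b : ℝ} (hab : a ≤ b) (z : ℝ) : 0 ≤ ramp a b z := by
  unfold ramp
  have : max (a - z) 0 ≤ max (b - z) 0 := max_le_max (by linarith) le_rfl
  linarith

lemma ramp_le {a b : ℝ} (hab : a ≤ b) (z : ℝ) : ramp a b z ≤ b - a := by
  unfold ramp
  have : max (b - z) 0 ≤ max (a - z) 0 + (b - a) := by
    apply max_le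
    · have := le_max_left (a - z) 0; linarith
    · have := le_max_right (a - z) 0; linarith
  linarith

lemma ramp_integrable (a b : ℝ) (hab : a ≤ b) (G : Measure ℝ) [IsProbabilityMeasure G] :
    Integrable (ramp a b) G := by
  refine Integrable.of_bound (C := b - a) (ramp_cont a b).aestronglyMeasurable
    (Eventually.of_forall fun y => ?_)
  rw [Real.norm_eq_abs, abs_of_nonneg (ramp_nonneg hab _)]; exact ramp_le hab _

lemma ramp_identity (G : Measure ℝ) [IsProbabilityMeasure G] {a b : ℝ} (hab : a ≤ b) :
    ∫ z, ramp a b z * mixDens laplaceDens G z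
      = ∫ y, ramp a b y ∂G + mixDens laplaceDens G b - mixDens laplaceDens G a := by
  have hC : ∀ z, |ramp a b z| ≤ b - a := fun z => by
    rw [abs_of_nonneg (ramp_nonneg hab _)]; exact ramp_le hab _
  rw [mix_mul_integral G _ (ramp_cont a b) _ hC]
  have : ∀ y, ∫ z, ramp a b z * laplaceDens (z - y)
      = ramp a b y + laplaceDens (b - y) - laplaceDens (a - y) := by
    intro y
    unfold ramp
    simp_rw [sub_mul]
    rw [integral_sub (hinge_shift b y).1 (hinge_shift a y).1, (hinge_shift b y).2, (hinge_shift a y).2]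
    ring
  simp_rw [this]
  have i1 : Integrable (fun y => ramp a b y + laplaceDens (b - y)) G :=
    (ramp_integrable a b hab G).add (mix_fiber_int G b)
  rw [integral_sub i1 (mix_fiber_int G a),
    integral_add (ramp_integrable a b hab G) (mix_fiber_int G b)]
  rfl

lemma cdf_le_ramp (G : Measure ℝ) [IsProbabilityMeasure G] {a b : ℝ} (hab : a ≤ b) :
    (b - a) * ProbabilityTheory.cdf G a ≤ ∫ y, ramp a b y ∂G ∧
      ∫ y, ramp a b y ∂G ≤ (b - a) * ProbabilityTheory.cdf G b := by
  have hi : ∀ c, Integrable ((Set.Iic c).indicator (fun _ : ℝ => b - a)) G := fun c =>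
    (integrable_const _).indicator measurableSet_Iic
  have he : ∀ c, ∫ y, (Set.Iic c).indicator (fun _ : ℝ => b - a) y ∂G
      = (b - a) * ProbabilityTheory.cdf G c := by
    intro c
    rw [integral_indicator_const _ measurableSet_Iic, ProbabilityTheory.cdf_eq_real, smul_eq_mul,
      mul_comm]
  constructor
  · rw [← he a]
    refine integral_mono (hi a) (ramp_integrable a b hab G) fun y => ?_
    by_cases hy : y ∈ Set.Iic a
    · rw [Set.indicator_of_mem hy]
      simp only [Set.mem_Iic] at hy
      unfold ramp
      rw [max_eq_left (by linarith), max_eq_left (by linarith)]; linarith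
    · rw [Set.indicator_of_notMem hy]; exact ramp_nonneg hab y
  · rw [← he b]
    refine integral_mono (ramp_integrable a b hab G) (hi b) fun y => ?_
    by_cases hy : y ∈ Set.Iic b
    · rw [Set.indicator_of_mem hy]; exact ramp_le hab y
    · rw [Set.indicator_of_notMem hy]
      simp only [Set.mem_Iic, not_le] at hy
      unfold ramp
      rw [max_eq_right (by linarith), max_eq_right (by linarith)]; linarith

/-- Exponential moment of the mixture. -/
lemma mix_exp_moment (G : Measure ℝ) [IsProbabilityMeasure G] {s : ℝ} (hs : 0 < s) (hs1 : s < 1)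
    (hG : Integrable (fun y => Real.exp (s * |y|)) G) :
    Integrable (fun x => Real.exp (s * |x|) * mixDens laplaceDens G x) := by
  have hL : Integrable (fun z => Real.exp (s * |z|) * laplaceDens z) := by
    have := (exp_abs_integrable (c := 1 - s) (by linarith)).const_mul (1/2)
    refine this.congr (Eventually.of_forall fun z => ?_)
    simp only [laplaceDens]
    rw [mul_left_comm, ← Real.exp_add]; ring_nf
  have hcont : Continuous (fun z : ℝ => Real.exp (s * |z|)) := by fun_prop
  have hdom : Integrable (fun p : ℝ × ℝ =>
      Real.exp (s * |p.2|) * (Real.exp (s * |p.1 - p.2|) * laplaceDens (p.1 - p.2)))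
      (volume.prod G) := by
    rw [integrable_prod_iff' (Continuous.aestronglyMeasurable (by
      have := lap_cont; fun_prop))]
    refine ⟨Eventually.of_forall fun y =>
      (hL.comp_sub_right y).const_mul (Real.exp (s * |y|)), ?_⟩
    have : ∀ y : ℝ, ∫ x, ‖Real.exp (s * |y|) * (Real.exp (s * |x - y|) * laplaceDens (x - y))‖
        = Real.exp (s * |y|) * ∫ x, ‖Real.exp (s * |x|) * laplaceDens x‖ := by
      intro y
      simp_rw [norm_mul (Real.exp (s * |y|))]
      rw [integral_const_mul,
        integral_sub_right_eq_self (fun w => ‖Real.exp (s * |w|) * laplaceDens w‖) y]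
      simp
    simp only [this]
    exact hG.mul_const _
  have hi : Integrable (fun p : ℝ × ℝ => Real.exp (s * |p.1|) * laplaceDens (p.1 - p.2))
      (volume.prod G) := by
    refine hdom.mono' (prod_meas _ hcont G) (Eventually.of_forall fun p => ?_)
    rw [Real.norm_eq_abs, abs_mul, abs_of_pos (lap_pos _), abs_of_pos (Real.exp_pos _), ← mul_assoc,
      ← Real.exp_add]
    apply mul_le_mul_of_nonneg_right _ (lap_pos _).le
    apply Real.exp_le_exp.2
    have : |p.1| ≤ |p.2| + |p.1 - p.2| := by
      have := abs_add_le p.2 (p.1 - p.2)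
      simpa using this
    nlinarith
  have := hi.integral_prod_left
  refine this.congr (Eventually.of_forall fun z => ?_)
  exact (mix_mul_eq G (fun z => Real.exp (s * |z|)) z).symm


/-! ### Law of one observation -/

/-- Law of one observation. -/
noncomputable def lawOf (G : Measure ℝ) : Measure ℝ :=
  volume.withDensity fun x => ENNReal.ofReal (mixDens laplaceDens G x)

instance lawOf_prob (G : Measure ℝ) [IsProbabilityMeasure G] : IsProbabilityMeasure (lawOf G) := by
  constructor
  rw [lawOf, withDensity_apply _ MeasurableSet.univ, Measure.restrict_univ,
    ← ofReal_integral_eq_lintegral_ofReal (mix_integrable G)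
      (Eventually.of_forall fun x => (mix_pos G x).le), mix_integral]
  simp

lemma law_integrable_iff (G : Measure ℝ) [IsProbabilityMeasure G] (g : ℝ → ℝ) :
    Integrable g (lawOf G) ↔ Integrable (fun x => g x * mixDens laplaceDens G x) := by
  rw [lawOf, integrable_withDensity_iff ((mix_cont G).measurable.ennreal_ofReal)
    (Eventually.of_forall fun x => ENNReal.ofReal_lt_top)]
  simp_rw [ENNReal.toReal_ofReal (mix_pos G _).le]

lemma law_integral (G : Measure ℝ) [IsProbabilityMeasure G] (g : ℝ → ℝ) :
    ∫ x, g x ∂(lawOf G) = ∫ x, g x * mixDens laplaceDens G x := by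
  rw [lawOf, integral_withDensity_eq_integral_toReal_smul ((mix_cont G).measurable.ennreal_ofReal)
    (Eventually.of_forall fun x => ENNReal.ofReal_lt_top)]
  simp_rw [ENNReal.toReal_ofReal (mix_pos G _).le, smul_eq_mul, mul_comm]

lemma law_exp_moment (G : Measure ℝ) [IsProbabilityMeasure G] {s : ℝ} (hs : 0 < s) (hs1 : s < 1)
    (hG : Integrable (fun y => Real.exp (s * |y|)) G) :
    Integrable (fun y => Real.exp (s * |y|)) (lawOf G) :=
  (law_integrable_iff G _).2 (mix_exp_moment G hs hs1 hG)

/-! ### Tails -/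

lemma tail_bound (μ : Measure ℝ) [IsProbabilityMeasure μ] {s : ℝ} (hs : 0 < s)
    (hG : Integrable (fun y => Real.exp (s * |y|)) μ) (t : ℝ) :
    μ.real {y | t ≤ |y|} ≤ (∫ y, Real.exp (s * |y|) ∂μ) * Real.exp (-(s * t)) := by
  have h := mul_meas_ge_le_integral_of_nonneg
    (Eventually.of_forall fun y => (Real.exp_pos (s * |y|)).le) hG (Real.exp (s * t))
  have hsub : μ.real {y | t ≤ |y|} ≤ μ.real {y | Real.exp (s * t) ≤ Real.exp (s * |y|)} := by
    apply measureReal_mono _ (measure_ne_top _ _)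
    intro y hy
    simp only [Set.mem_ofPred_eq] at hy ⊢
    exact Real.exp_le_exp.2 (mul_le_mul_of_nonneg_left hy hs.le)
  have hp := Real.exp_pos (s * t)
  rw [Real.exp_neg, ← div_eq_mul_inv, le_div_iff₀ hp]
  calc _ ≤ μ.real {y | Real.exp (s * t) ≤ Real.exp (s * |y|)} * Real.exp (s * t) := by gcongr
    _ = _ := mul_comm _ _
    _ ≤ _ := h

lemma cdf_left (μ : Measure ℝ) [IsProbabilityMeasure μ] {x : ℝ} (hx : x ≤ 0) :
    ProbabilityTheory.cdf μ x ≤ μ.real {y | |x| ≤ |y|} := by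
  rw [ProbabilityTheory.cdf_eq_real]
  apply measureReal_mono _ (measure_ne_top _ _)
  intro y hy
  simp only [Set.mem_Iic] at hy
  simp only [Set.mem_ofPred_eq]
  rw [abs_of_nonpos hx, abs_of_nonpos (hy.trans hx)]; linarith

lemma cdf_right (μ : Measure ℝ) [IsProbabilityMeasure μ] {x : ℝ} (hx : 0 ≤ x) :
    1 - ProbabilityTheory.cdf μ x ≤ μ.real {y | |x| ≤ |y|} := by
  rw [ProbabilityTheory.cdf_eq_real, ← probReal_compl_eq_one_sub measurableSet_Iic]
  apply measureReal_mono _ (measure_ne_top _ _)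
  intro y hy
  simp only [Set.mem_compl_iff, Set.mem_Iic, not_le] at hy
  simp only [Set.mem_ofPred_eq]
  rw [abs_of_nonneg hx, abs_of_nonneg (hx.trans hy.le)]; linarith

lemma cdf_var_bound (μ : Measure ℝ) [IsProbabilityMeasure μ] {s : ℝ} (hs : 0 < s)
    (hG : Integrable (fun y => Real.exp (s * |y|)) μ) (x : ℝ) :
    ProbabilityTheory.cdf μ x * (1 - ProbabilityTheory.cdf μ x)
      ≤ (∫ y, Real.exp (s * |y|) ∂μ) * Real.exp (-(s * |x|)) := by
  have h0 := ProbabilityTheory.cdf_nonneg μ x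
  have h1 := ProbabilityTheory.cdf_le_one μ x
  have ht := tail_bound μ hs hG |x|
  rcases le_total x 0 with hx | hx
  · have := cdf_left μ hx; nlinarith
  · have := cdf_right μ hx; nlinarith

lemma tail_cdfDist (G G₀ : Measure ℝ) [IsProbabilityMeasure G] [IsProbabilityMeasure G₀] {s R : ℝ}
    (hs : 0 < s)
    (hG : Integrable (fun y => Real.exp (s * |y|)) G₀) (hsupp : G (Set.Icc (-R) R)ᶜ = 0) :
    ∫⁻ x in (Set.Icc (-R) R)ᶜ,
      ENNReal.ofReal |ProbabilityTheory.cdf G x - ProbabilityTheory.cdf G₀ x|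
      ≤ ENNReal.ofReal ((∫ y, Real.exp (s * |y|) ∂G₀) * (∫ x : ℝ, Real.exp (-(s / 2 * |x|)))
          * Real.exp (-(s / 2 * R))) := by
  set C := ∫ y, Real.exp (s * |y|) ∂G₀ with hC
  have hC0 : 0 ≤ C := integral_nonneg fun y => (Real.exp_pos _).le
  have hint := exp_abs_integrable (c := s / 2) (by linarith)
  have hpt : ∀ x ∈ (Set.Icc (-R) R)ᶜ,
      |ProbabilityTheory.cdf G x - ProbabilityTheory.cdf G₀ x|
        ≤ (C * Real.exp (-(s/2*R))) * Real.exp (-(s/2*|x|)) := by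
    intro x hx
    have ht := tail_bound G₀ hs hG |x|
    have hxR : R < |x| := by
      by_contra hcon
      push Not at hcon
      exact hx ⟨by have := neg_abs_le x; linarith, by have := le_abs_self x; linarith⟩
    have hexp : Real.exp (-(s * |x|)) ≤ Real.exp (-(s/2*R)) * Real.exp (-(s/2*|x|)) := by
      rw [← Real.exp_add]; apply Real.exp_le_exp.2; nlinarith
    have hfin : G₀.real {y | |x| ≤ |y|} ≤ (C * Real.exp (-(s/2*R))) * Real.exp (-(s/2*|x|)) := by
      refine ht.trans ?_
      rw [mul_assoc]
      exact mul_le_mul_of_nonneg_left hexp hC0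
    refine le_trans ?_ hfin
    rcases le_total x 0 with h0 | h0
    · have hx' : x < -R := by rw [abs_of_nonpos h0] at hxR; linarith
      have : ProbabilityTheory.cdf G x = 0 := by
        rw [ProbabilityTheory.cdf_eq_real, measureReal_def,
          measure_mono_null (fun y hy => ?_) hsupp]
        · simp
        · simp only [Set.mem_Iic] at hy
          intro hy2
          have := hy2.1
          linarith
      rw [this, zero_sub, abs_neg, abs_of_nonneg (ProbabilityTheory.cdf_nonneg _ _)]
      exact cdf_left G₀ h0
    · have hx' : R < x := by rwa [abs_of_nonneg h0] at hxR
      have : ProbabilityTheory.cdf G x = 1 := by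
        rw [ProbabilityTheory.cdf_eq_real]
        have hc : G.real (Set.Iic x)ᶜ = 0 := by
          rw [measureReal_def, measure_mono_null (fun y hy => ?_) hsupp]
          · simp
          · simp only [Set.mem_compl_iff, Set.mem_Iic, not_le] at hy
            intro hy2
            have := hy2.2
            linarith
        rw [probReal_compl_eq_one_sub measurableSet_Iic] at hc
        linarith
      rw [this, abs_of_nonneg (by have := ProbabilityTheory.cdf_le_one G₀ x; linarith)]
      exact cdf_right G₀ h0
  calc _ ≤ ∫⁻ x in (Set.Icc (-R) R)ᶜ,
        ENNReal.ofReal ((C * Real.exp (-(s/2*R))) * Real.exp (-(s/2*|x|))) :=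
        setLIntegral_mono' measurableSet_Icc.compl
          fun x hx => ENNReal.ofReal_le_ofReal (hpt x hx)
    _ ≤ ∫⁻ x, ENNReal.ofReal ((C * Real.exp (-(s/2*R))) * Real.exp (-(s/2*|x|))) :=
        setLIntegral_le_lintegral _ _
    _ = _ := by
        rw [← ofReal_integral_eq_lintegral_ofReal (hint.const_mul _)
          (Eventually.of_forall fun x => by positivity), integral_const_mul]
        congr 1; ring

/-! ### Deconvolution inequality -/

lemma cdf_shift_int (G : Measure ℝ) [IsProbabilityMeasure G] (ε : ℝ) :
    ∫⁻ x, ENNReal.ofReal (ProbabilityTheory.cdf G (x + ε) - ProbabilityTheory.cdf G x)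
      ≤ ENNReal.ofReal ε := by
  set A : Set (ℝ × ℝ) := {p | p.1 < p.2 ∧ p.2 ≤ p.1 + ε} with hA
  have hAm : MeasurableSet A :=
    (measurableSet_lt measurable_fst measurable_snd).inter
      (measurableSet_le measurable_snd (measurable_fst.add_const ε))
  calc _ = ∫⁻ x, ∫⁻ y, A.indicator 1 (x, y) ∂G := by
        apply lintegral_congr
        intro x
        have : (fun y => A.indicator (1 : ℝ × ℝ → ENNReal) (x, y))
            = (Set.Ioc x (x + ε)).indicator 1 := by
          ext y; simp [Set.indicator, hA]
        rw [this, lintegral_indicator_one measurableSet_Ioc,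
          ← StieltjesFunction.measure_Ioc, ProbabilityTheory.measure_cdf]
    _ = ∫⁻ y, (∫⁻ x, A.indicator 1 (x, y)) ∂G := by
        apply lintegral_lintegral_swap
        exact (measurable_one.indicator hAm).aemeasurable
    _ = ∫⁻ y, ENNReal.ofReal ε ∂G := by
        apply lintegral_congr
        intro y
        have : (fun x => A.indicator (1 : ℝ × ℝ → ENNReal) (x, y))
            = (Set.Ico (y - ε) y).indicator 1 := by
          ext x
          simp only [Set.indicator, hA, Set.mem_ofPred_eq, Set.mem_Ico, tsub_le_iff_right]
          congr 1
          simp only [eq_iff_iff]; tauto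
        rw [this, lintegral_indicator_one measurableSet_Ico, Real.volume_Ico]
        congr 1; ring
    _ ≤ _ := by simp

/-- `L¹` distance of mixtures. -/
noncomputable def mixD (G G₀ : Measure ℝ) : ℝ :=
  ∫ x, |mixDens laplaceDens G x - mixDens laplaceDens G₀ x|

lemma mixD_nonneg (G G₀ : Measure ℝ) : 0 ≤ mixD G G₀ := integral_nonneg fun _ => abs_nonneg _

lemma mixd_integrable (G G₀ : Measure ℝ) [IsProbabilityMeasure G] [IsProbabilityMeasure G₀] :
    Integrable (fun x => |mixDens laplaceDens G x - mixDens laplaceDens G₀ x|) :=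
  ((mix_integrable G).sub (mix_integrable G₀)).abs

lemma cdf_pt (G G₀ : Measure ℝ) [IsProbabilityMeasure G] [IsProbabilityMeasure G₀] {ε : ℝ}
    (hε : 0 < ε) (x : ℝ) :
    |ProbabilityTheory.cdf G x - ProbabilityTheory.cdf G₀ x| ≤
      mixD G G₀ + (|mixDens laplaceDens G (x + ε) - mixDens laplaceDens G₀ (x + ε)|
        + |mixDens laplaceDens G x - mixDens laplaceDens G₀ x|) / ε
      + (ProbabilityTheory.cdf G (x + ε) - ProbabilityTheory.cdf G x)
      + (ProbabilityTheory.cdf G₀ (x + ε) - ProbabilityTheory.cdf G₀ x) := by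
  have hab : x ≤ x + ε := by linarith
  have i1 := ramp_identity G hab
  have i0 := ramp_identity G₀ hab
  have c1 := cdf_le_ramp G hab
  have c0 := cdf_le_ramp G₀ hab
  rw [add_sub_cancel_left] at c1 c0
  have hC : ∀ z, |ramp x (x + ε) z| ≤ ε := fun z => by
    rw [abs_of_nonneg (ramp_nonneg hab _)]
    have := ramp_le hab z; linarith
  have hd : |(∫ z, ramp x (x+ε) z * mixDens laplaceDens G z)
      - ∫ z, ramp x (x+ε) z * mixDens laplaceDens G₀ z| ≤ ε * mixD G G₀ := by
    rw [← integral_sub (mix_mul_integrable G _ (ramp_cont _ _) _ hC)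
      (mix_mul_integrable G₀ _ (ramp_cont _ _) _ hC), mixD, ← integral_const_mul, ← Real.norm_eq_abs]
    refine norm_integral_le_of_norm_le ((mixd_integrable G G₀).const_mul ε)
      (Eventually.of_forall fun z => ?_)
    rw [← mul_sub, Real.norm_eq_abs, abs_mul]
    exact mul_le_mul_of_nonneg_right (hC z) (abs_nonneg _)
  set U := ∫ y, ramp x (x + ε) y ∂G
  set U0 := ∫ y, ramp x (x + ε) y ∂G₀
  rw [i1, i0] at hd
  have hUd : |U - U0| ≤ ε * mixD G G₀
      + (|mixDens laplaceDens G (x + ε) - mixDens laplaceDens G₀ (x + ε)|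
        + |mixDens laplaceDens G x - mixDens laplaceDens G₀ x|) := by
    have e : U - U0 = (U + mixDens laplaceDens G (x+ε) - mixDens laplaceDens G x
        - (U0 + mixDens laplaceDens G₀ (x+ε) - mixDens laplaceDens G₀ x))
        - (mixDens laplaceDens G (x + ε) - mixDens laplaceDens G₀ (x + ε))
        + (mixDens laplaceDens G x - mixDens laplaceDens G₀ x) := by ring
    rw [e]
    refine (abs_add_le _ _).trans ?_
    have := abs_sub (U + mixDens laplaceDens G (x+ε) - mixDens laplaceDens G x
        - (U0 + mixDens laplaceDens G₀ (x+ε) - mixDens laplaceDens G₀ x))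
        (mixDens laplaceDens G (x + ε) - mixDens laplaceDens G₀ (x + ε))
    linarith
  rw [abs_le] at hUd
  set B := |mixDens laplaceDens G (x + ε) - mixDens laplaceDens G₀ (x + ε)|
        + |mixDens laplaceDens G x - mixDens laplaceDens G₀ x|
  have key : ε * |ProbabilityTheory.cdf G x - ProbabilityTheory.cdf G₀ x| ≤
      ε * mixD G G₀ + B + ε * (ProbabilityTheory.cdf G (x + ε) - ProbabilityTheory.cdf G x)
      + ε * (ProbabilityTheory.cdf G₀ (x + ε) - ProbabilityTheory.cdf G₀ x) := by
    rw [← abs_of_pos hε, ← abs_mul, abs_of_pos hε, abs_le]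
    constructor <;> nlinarith
  have : ε * (mixD G G₀ + B / ε
      + (ProbabilityTheory.cdf G (x + ε) - ProbabilityTheory.cdf G x)
      + (ProbabilityTheory.cdf G₀ (x + ε) - ProbabilityTheory.cdf G₀ x))
      = ε * mixD G G₀ + B + ε * (ProbabilityTheory.cdf G (x + ε) - ProbabilityTheory.cdf G x)
      + ε * (ProbabilityTheory.cdf G₀ (x + ε) - ProbabilityTheory.cdf G₀ x) := by
    field_simp
  rw [← this] at key
  exact le_of_mul_le_mul_left key hε

lemma deconv (G G₀ : Measure ℝ) [IsProbabilityMeasure G] [IsProbabilityMeasure G₀] {ε R : ℝ}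
    (hε : 0 < ε) (hR : 0 ≤ R) :
    ∫⁻ x in Set.Icc (-R) R,
      ENNReal.ofReal |ProbabilityTheory.cdf G x - ProbabilityTheory.cdf G₀ x|
      ≤ ENNReal.ofReal (2 * R * mixD G G₀ + 2 * mixD G G₀ / ε + 2 * ε) := by
  have hD := mixD_nonneg G G₀
  set d := fun x => |mixDens laplaceDens G x - mixDens laplaceDens G₀ x| with hd
  have hdi : Integrable d := mixd_integrable G G₀
  have hdi2 : Integrable (fun x => (d (x + ε) + d x) / ε) :=
    ((hdi.comp_add_right ε).add hdi).div_const ε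
  have hmd : Measurable d := by
    have h1 := (mix_cont G).measurable
    have h2 := (mix_cont G₀).measurable
    exact (h1.sub h2).abs
  have hB : ∫⁻ x, ENNReal.ofReal ((d (x + ε) + d x) / ε) = ENNReal.ofReal (2 * mixD G G₀ / ε) := by
    rw [← ofReal_integral_eq_lintegral_ofReal hdi2 (Eventually.of_forall fun x => by
      simp only [hd, Pi.zero_apply]; positivity), integral_div,
      integral_add (hdi.comp_add_right ε) hdi, integral_add_right_eq_self d ε]
    congr 1
    simp only [mixD, hd]; ring
  have hF : ∀ μ : Measure ℝ, Measurable fun x => ENNReal.ofReal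
      (ProbabilityTheory.cdf μ (x + ε) - ProbabilityTheory.cdf μ x) := fun μ => by
    have h := (ProbabilityTheory.monotone_cdf μ).measurable
    exact ((h.comp (measurable_id.add_const ε)).sub h).ennreal_ofReal
  have hmB : Measurable fun x => ENNReal.ofReal ((d (x + ε) + d x) / ε) :=
    (((hmd.comp (measurable_id.add_const ε)).add hmd).div_const ε).ennreal_ofReal
  calc _ ≤ ∫⁻ x in Set.Icc (-R) R, (ENNReal.ofReal (mixD G G₀)
        + (ENNReal.ofReal ((d (x + ε) + d x) / ε)
        + (ENNReal.ofReal (ProbabilityTheory.cdf G (x + ε) - ProbabilityTheory.cdf G x)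
        + ENNReal.ofReal (ProbabilityTheory.cdf G₀ (x + ε) - ProbabilityTheory.cdf G₀ x)))) := by
        apply lintegral_mono
        intro x
        have m1 : ∀ μ : Measure ℝ,
            0 ≤ ProbabilityTheory.cdf μ (x + ε) - ProbabilityTheory.cdf μ x := fun μ =>
          sub_nonneg.2 (ProbabilityTheory.monotone_cdf μ (by linarith))
        have m2 : 0 ≤ (d (x + ε) + d x) / ε := by simp only [hd]; positivity
        simp only
        rw [← ENNReal.ofReal_add (m1 G) (m1 G₀), ← ENNReal.ofReal_add m2 (add_nonneg (m1 G) (m1 G₀)),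
          ← ENNReal.ofReal_add hD (add_nonneg m2 (add_nonneg (m1 G) (m1 G₀)))]
        apply ENNReal.ofReal_le_ofReal
        have := cdf_pt G G₀ hε x
        simp only [hd]
        linarith
    _ = ENNReal.ofReal (2 * R * mixD G G₀)
        + ((∫⁻ x in Set.Icc (-R) R, ENNReal.ofReal ((d (x + ε) + d x) / ε))
        + ((∫⁻ x in Set.Icc (-R) R,
            ENNReal.ofReal (ProbabilityTheory.cdf G (x + ε) - ProbabilityTheory.cdf G x))
        + (∫⁻ x in Set.Icc (-R) R,
            ENNReal.ofReal (ProbabilityTheory.cdf G₀ (x + ε) - ProbabilityTheory.cdf G₀ x)))) := by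
        rw [lintegral_add_left measurable_const, lintegral_add_left hmB, lintegral_add_left (hF G),
          setLIntegral_const, Real.volume_Icc, ← ENNReal.ofReal_mul hD]
        congr 2; ring
    _ ≤ ENNReal.ofReal (2 * R * mixD G G₀)
        + (ENNReal.ofReal (2 * mixD G G₀ / ε) + (ENNReal.ofReal ε + ENNReal.ofReal ε)) := by
        gcongr
        · exact (setLIntegral_le_lintegral _ _).trans hB.le
        · exact (setLIntegral_le_lintegral _ _).trans (cdf_shift_int G ε)
        · exact (setLIntegral_le_lintegral _ _).trans (cdf_shift_int G₀ ε)
    _ = _ := by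
        rw [← ENNReal.ofReal_add hε.le hε.le, ← ENNReal.ofReal_add (by positivity) (by positivity),
          ← ENNReal.ofReal_add (by positivity) (by positivity)]
        congr 1; ring


/-! ### Support of the maximum likelihood estimator -/

lemma mle_support {n : ℕ} (hn : 0 < n) (x : Fin n → ℝ) {R : ℝ} (hR : 0 ≤ R) (hx : ∀ i, |x i| ≤ R)
    (G : Measure ℝ) [IsProbabilityMeasure G]
    (hM : ∀ G' : Measure ℝ, IsProbabilityMeasure G' →
      ∑ i : Fin n, Real.log (mixDens laplaceDens G' (x i)) ≤
        ∑ i : Fin n, Real.log (mixDens laplaceDens G (x i))) :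
    G (Set.Icc (-R) R)ᶜ = 0 := by
  by_contra hne
  set T : ℝ → ℝ := fun y => max (-R) (min R y) with hT
  have hTc : Continuous T := by fun_prop
  have hTm : Measurable T := hTc.measurable
  have hle : ∀ a y : ℝ, |a| ≤ R → |a - T y| ≤ |a - y| := by
    intro a y ha
    have h1 := (abs_le.1 ha).1
    have h2 := (abs_le.1 ha).2
    simp only [hT]
    rcases le_total R y with h | h
    · rw [min_eq_left h, max_eq_right (by linarith), abs_of_nonpos (by linarith),
        abs_of_nonpos (by linarith)]; linarith
    · rw [min_eq_right h]
      rcases le_total (-R) y with h' | h'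
      · rw [max_eq_right h']
      · rw [max_eq_left h', abs_of_nonneg (by linarith), abs_of_nonneg (by linarith)]; linarith
  have hlt : ∀ a y : ℝ, |a| ≤ R → y ∈ (Set.Icc (-R) R)ᶜ → |a - T y| < |a - y| := by
    intro a y ha hy
    have h1 := (abs_le.1 ha).1
    have h2 := (abs_le.1 ha).2
    simp only [hT]
    rcases lt_or_ge R y with h | h
    · rw [min_eq_left h.le, max_eq_right (by linarith), abs_of_nonpos (by linarith),
        abs_of_nonpos (by linarith)]; linarith
    · have h' : y < -R := by
        by_contra hc
        push Not at hc
        exact hy ⟨hc, h⟩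
      rw [min_eq_right h, max_eq_left h'.le, abs_of_nonneg (by linarith),
        abs_of_nonneg (by linarith)]; linarith
  have hprob : IsProbabilityMeasure (G.map T) := Measure.isProbabilityMeasure_map hTm.aemeasurable
  have hstrict : ∀ i, mixDens laplaceDens G (x i) < mixDens laplaceDens (G.map T) (x i) := by
    intro i
    have hi2 : Integrable (fun y => laplaceDens (x i - T y)) G := by
      refine Integrable.of_bound (C := 1)
        (Continuous.aestronglyMeasurable (lap_cont.comp (by fun_prop)))
        (Eventually.of_forall fun y => ?_)
      rw [Real.norm_eq_abs, abs_of_pos (lap_pos _)]; exact lap_le _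
    have he : mixDens laplaceDens (G.map T) (x i) = ∫ y, laplaceDens (x i - T y) ∂G := by
      have hm : AEStronglyMeasurable (fun y => laplaceDens (x i - y)) (G.map T) :=
        Continuous.aestronglyMeasurable (lap_cont.comp (by fun_prop))
      unfold mixDens
      rw [integral_map hTm.aemeasurable hm]
    have hi3 : Integrable (fun y => laplaceDens (x i - T y) - laplaceDens (x i - y)) G :=
      hi2.sub (mix_fiber_int G (x i))
    rw [he, mixDens, ← sub_pos, ← integral_sub hi2 (mix_fiber_int G (x i)),
      integral_pos_iff_support_of_nonneg (fun y => ?_) hi3]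
    · refine lt_of_lt_of_le (pos_iff_ne_zero.2 hne) (measure_mono fun y hy => ?_)
      have := hlt (x i) y (hx i) hy
      simp only [Function.mem_support, ne_eq, sub_eq_zero]
      apply ne_of_gt
      unfold laplaceDens
      have := Real.exp_lt_exp.2 (neg_lt_neg this)
      linarith
    · simp only [Pi.zero_apply, sub_nonneg]
      unfold laplaceDens
      have := Real.exp_le_exp.2 (neg_le_neg (hle (x i) y (hx i)))
      linarith
  have := hM (G.map T) hprob
  have h2 : ∑ i : Fin n, Real.log (mixDens laplaceDens G (x i))
      < ∑ i : Fin n, Real.log (mixDens laplaceDens (G.map T) (x i)) := by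
    apply Finset.sum_lt_sum_of_nonempty
    · exact ⟨⟨0, hn⟩, Finset.mem_univ _⟩
    · intro i _
      exact Real.log_lt_log (mix_pos G _) (hstrict i)
  linarith

/-! ### Empirical measure -/

/-- Empirical measure. -/
noncomputable def emp {n : ℕ} (x : Fin n → ℝ) : Measure ℝ :=
  (n : ENNReal)⁻¹ • ∑ i, Measure.dirac (x i)

lemma emp_prob {n : ℕ} (hn : 0 < n) (x : Fin n → ℝ) : IsProbabilityMeasure (emp x) := by
  constructor
  simp only [emp, Measure.smul_apply, Measure.finsetSum_apply, measure_univ, Finset.sum_const,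
    Finset.card_univ, Fintype.card_fin, smul_eq_mul, nsmul_eq_mul, mul_one]
  exact ENNReal.inv_mul_cancel (by exact_mod_cast hn.ne') (by simp)

lemma emp_integrable {n : ℕ} (hn : 0 < n) (x : Fin n → ℝ) (g : ℝ → ℝ) : Integrable g (emp x) := by
  unfold emp
  apply Integrable.smul_measure
  · rw [integrable_finsetSum_measure]
    intro i _
    exact integrable_dirac (by simp)
  · simp [hn.ne']

lemma emp_integral {n : ℕ} (x : Fin n → ℝ) (g : ℝ → ℝ) :
    ∫ y, g y ∂(emp x) = (n : ℝ)⁻¹ * ∑ i, g (x i) := by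
  unfold emp
  rw [integral_smul_measure, integral_finsetSum_measure (fun i _ => integrable_dirac (by simp))]
  simp

lemma emp_cdf {n : ℕ} (hn : 0 < n) (x : Fin n → ℝ) (t : ℝ) :
    ProbabilityTheory.cdf (emp x) t
      = (n : ℝ)⁻¹ * ∑ i, (Set.Iic t).indicator (fun _ => (1 : ℝ)) (x i) := by
  have := emp_prob hn x
  rw [ProbabilityTheory.cdf_eq_real, ← emp_integral, integral_indicator_const _ measurableSet_Iic]
  simp

/-! ### Likelihood inequality -/

lemma abs_integrable_of_exp (μ : Measure ℝ) {s : ℝ} (hs : 0 < s)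
    (hG : Integrable (fun y => Real.exp (s * |y|)) μ) : Integrable (fun y : ℝ => |y|) μ := by
  refine (hG.const_mul s⁻¹).mono' (by fun_prop) (Eventually.of_forall fun y => ?_)
  rw [Real.norm_eq_abs, abs_abs, inv_mul_eq_div, le_div_iff₀ hs]
  have := Real.add_one_le_exp (s * |y|)
  linarith

lemma likelihood_bound {n : ℕ} (hn : 0 < n) (x : Fin n → ℝ)
    (G G₀ : Measure ℝ) [IsProbabilityMeasure G] [IsProbabilityMeasure G₀]
    {s : ℝ} (hs : 0 < s) (hs1 : s < 1) (hG : Integrable (fun y => Real.exp (s * |y|)) G₀)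
    (hM : ∑ i : Fin n, Real.log (mixDens laplaceDens G₀ (x i)) ≤
        ∑ i : Fin n, Real.log (mixDens laplaceDens G (x i)))
    (hfin : cdfDist (emp x) (lawOf G₀) ≠ ⊤) {l : ℝ} (hl : 0 < l) :
    mixD G G₀ ≤ l * (cdfDist (emp x) (lawOf G₀)).toReal + 2 / l := by
  have := emp_prob hn x
  set p := mixDens laplaceDens G with hp
  set q := mixDens laplaceDens G₀ with hq
  have hp0 : ∀ z, 0 < p z := mix_pos G
  have hq0 : ∀ z, 0 < q z := mix_pos G₀
  have hpi : Integrable p := mix_integrable G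
  have hqi : Integrable q := mix_integrable G₀
  have hp1 : ∫ z, p z = 1 := mix_integral G
  have hq1 : ∫ z, q z = 1 := mix_integral G₀
  set g : ℝ → ℝ := fun z => Real.log (p z) - Real.log (q z) with hg
  have hgl : ∀ a b, |g a - g b| ≤ 2 * |a - b| := by
    intro a b
    have e : g a - g b = (Real.log (p a) - Real.log (p b)) - (Real.log (q a) - Real.log (q b)) := by
      simp only [hg]; ring
    rw [e]
    have h1 := log_mix_lip G a b
    have h2 := log_mix_lip G₀ a b
    refine (abs_sub _ _).trans ?_
    linarith
  have hgc : Continuous g := (log_mix_cont G).sub (log_mix_cont G₀)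
  have hgi : Integrable g (lawOf G₀) := by
    have h1 := abs_integrable_of_exp (lawOf G₀) hs (law_exp_moment G₀ hs hs1 hG)
    refine ((integrable_const |g 0|).add (h1.const_mul 2)).mono' hgc.aestronglyMeasurable
      (Eventually.of_forall fun z => ?_)
    have := hgl z 0
    have h3 := abs_sub_abs_le_abs_sub (g z) (g 0)
    simp only [sub_zero] at this
    simp only [Real.norm_eq_abs, Pi.add_apply]
    linarith
  have hlip := lip_bound (emp x) (lawOf G₀) hfin g hgl (emp_integrable hn x g) hgi
  have h0 : 0 ≤ ∫ z, g z ∂(emp x) := by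
    rw [emp_integral]
    apply mul_nonneg (by positivity)
    simp only [hg, Finset.sum_sub_distrib]
    linarith
  rw [law_integral] at hlip
  rw [law_integrable_iff] at hgi
  have hsi : Integrable (fun z => √(p z * q z)) := by
    refine (hpi.add hqi).mono' ?_ (Eventually.of_forall fun z => ?_)
    · exact Continuous.aestronglyMeasurable
        (Real.continuous_sqrt.comp ((mix_cont G).mul (mix_cont G₀)))
    · rw [Real.norm_eq_abs, abs_of_nonneg (Real.sqrt_nonneg _), Pi.add_apply]
      apply Real.sqrt_le_iff.2
      have := hp0 z
      have := hq0 z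
      constructor
      · linarith
      · nlinarith
  have hKL : ∫ z, g z * q z ≤ 2 * (∫ z, √(p z * q z)) - 2 := by
    have ik : Integrable (fun z => 2 * √(p z * q z) - 2 * q z) :=
      (hsi.const_mul 2).sub (hqi.const_mul 2)
    calc ∫ z, g z * q z ≤ ∫ z, (2 * √(p z * q z) - 2 * q z) := by
          apply integral_mono hgi ik
          intro z
          have hpz := hp0 z
          have hqz := hq0 z
          have e : g z = 2 * Real.log (√(p z * q z) / q z) := by
            rw [Real.log_div (Real.sqrt_pos.2 (by positivity)).ne' hqz.ne',
              Real.log_sqrt (by positivity), Real.log_mul hpz.ne' hqz.ne']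
            simp only [hg]; ring
          have h1 : Real.log (√(p z * q z) / q z) ≤ √(p z * q z) / q z - 1 :=
            Real.log_le_sub_one_of_pos (div_pos (Real.sqrt_pos.2 (by positivity)) hqz)
          simp only
          rw [e]
          calc 2 * Real.log (√(p z * q z) / q z) * q z
              ≤ 2 * (√(p z * q z) / q z - 1) * q z := by gcongr
            _ = _ := by field_simp
      _ = _ := by
          rw [integral_sub (hsi.const_mul 2) (hqi.const_mul 2), integral_const_mul,
            integral_const_mul, hq1]
          ring
  have hD : mixD G G₀ ≤ l / 2 * (2 - 2 * ∫ z, √(p z * q z)) + 2 / l := by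
    have hi : Integrable (fun z => l / 2 * (p z + q z - 2 * √(p z * q z)) + (p z + q z) / l) :=
      (((hpi.add hqi).sub (hsi.const_mul 2)).const_mul (l/2)).add ((hpi.add hqi).div_const l)
    calc mixD G G₀ ≤ ∫ z, (l / 2 * (p z + q z - 2 * √(p z * q z)) + (p z + q z) / l) := by
          apply integral_mono (mixd_integrable G G₀) hi
          intro z
          have hpz := hp0 z
          have hqz := hq0 z
          simp only
          rw [Real.sqrt_mul hpz.le]
          set u := √(p z) with hu
          set v := √(q z) with hv
          have hu2 : u ^ 2 = p z := Real.sq_sqrt hpz.le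
          have hv2 : v ^ 2 = q z := Real.sq_sqrt hqz.le
          change |p z - q z| ≤ _
          rw [← hu2, ← hv2]
          have e : l / 2 * (u^2 + v^2 - 2 * (u * v)) + (u^2 + v^2) / l
              = (l * (u - v)^2 + (u + v)^2 / l) / 2 + (u - v)^2 / l / 2 := by ring
          have h3 : 2 * |u ^ 2 - v ^ 2| ≤ l * (u - v)^2 + (u + v)^2 / l := by
            have e2 : u^2 - v^2 = (u - v) * (u + v) := by ring
            rw [e2, abs_mul]
            have := sq_nonneg (l * |u - v| - |u + v|)
            have h5 : l * (l * (u - v)^2 + (u + v)^2 / l) = (l * |u - v|)^2 + |u + v|^2 := by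
              rw [mul_pow, sq_abs, sq_abs]; field_simp
            refine le_of_mul_le_mul_left ?_ hl
            rw [h5]
            nlinarith
          have h4 : 0 ≤ (u - v)^2 / l / 2 := by positivity
          rw [e]
          linarith
      _ = _ := by
          have ii := (hpi.add hqi).sub (hsi.const_mul 2)
          have e1 : ∫ z, l / 2 * (p z + q z - 2 * √(p z * q z))
              = l / 2 * (2 - 2 * ∫ z, √(p z * q z)) := by
            have ia : Integrable (fun z => p z + q z) := hpi.add hqi
            rw [integral_const_mul, integral_sub ia (hsi.const_mul 2), integral_add hpi hqi,
              hp1, hq1, integral_const_mul]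
            norm_num
          have e2 : ∫ z, (p z + q z) / l = 2 / l := by
            rw [integral_div, integral_add hpi hqi, hp1, hq1]; norm_num
          have ii' : Integrable (fun z => l / 2 * (p z + q z - 2 * √(p z * q z))) :=
            ii.const_mul (l/2)
          have jj' : Integrable (fun z => (p z + q z) / l) := (hpi.add hqi).div_const l
          rw [integral_add ii' jj', e1, e2]
  nlinarith


/-! ### Empirical process bound -/

lemma ind_memLp (μ : Measure ℝ) [IsProbabilityMeasure μ] (t : ℝ) :
    MemLp (fun y => (Set.Iic t).indicator (fun _ => (1 : ℝ)) y - ProbabilityTheory.cdf μ t) 2 μ := by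
  refine MemLp.sub ?_ (memLp_const _)
  exact (memLp_const (1 : ℝ)).indicator measurableSet_Iic

lemma ind_mean (μ : Measure ℝ) [IsProbabilityMeasure μ] (t : ℝ) :
    ∫ y, ((Set.Iic t).indicator (fun _ => (1 : ℝ)) y - ProbabilityTheory.cdf μ t) ∂μ = 0 := by
  rw [integral_sub ((integrable_const _).indicator measurableSet_Iic) (integrable_const _),
    integral_indicator_const _ measurableSet_Iic, ProbabilityTheory.cdf_eq_real]
  simp

lemma ind_var (μ : Measure ℝ) [IsProbabilityMeasure μ] (t : ℝ) :
    ∫ y, ((Set.Iic t).indicator (fun _ => (1 : ℝ)) y - ProbabilityTheory.cdf μ t) ^ 2 ∂μ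
      = ProbabilityTheory.cdf μ t * (1 - ProbabilityTheory.cdf μ t) := by
  set F := ProbabilityTheory.cdf μ t with hF
  have e : ∀ y, ((Set.Iic t).indicator (fun _ => (1 : ℝ)) y - F) ^ 2
      = (1 - 2 * F) * (Set.Iic t).indicator (fun _ => (1 : ℝ)) y + F ^ 2 := by
    intro y
    by_cases h : y ∈ Set.Iic t
    · rw [Set.indicator_of_mem h]; ring
    · rw [Set.indicator_of_notMem h]; ring
  simp_rw [e]
  rw [integral_add (((integrable_const _).indicator measurableSet_Iic).const_mul _)
    (integrable_const _), integral_const_mul,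
    integral_indicator_const _ measurableSet_Iic, ← ProbabilityTheory.cdf_eq_real, ← hF]
  simp
  ring

lemma emp_var {n : ℕ} (hn : 0 < n) (μ : Measure ℝ) [IsProbabilityMeasure μ] (t : ℝ) :
    Integrable (fun x : Fin n → ℝ =>
      (ProbabilityTheory.cdf (emp x) t - ProbabilityTheory.cdf μ t) ^ 2) (Measure.pi fun _ => μ) ∧
    ∫ x : Fin n → ℝ, (ProbabilityTheory.cdf (emp x) t - ProbabilityTheory.cdf μ t) ^ 2
      ∂(Measure.pi fun _ => μ)
      = ProbabilityTheory.cdf μ t * (1 - ProbabilityTheory.cdf μ t) / n := by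
  set X : ℝ → ℝ := fun y => (Set.Iic t).indicator (fun _ => (1 : ℝ)) y - ProbabilityTheory.cdf μ t
    with hX
  have hXm : MemLp X 2 μ := ind_memLp μ t
  have hn' : (n : ℝ) ≠ 0 := by exact_mod_cast hn.ne'
  have e : ∀ x : Fin n → ℝ, ProbabilityTheory.cdf (emp x) t - ProbabilityTheory.cdf μ t
      = (n : ℝ)⁻¹ * (∑ i, fun ω : Fin n → ℝ => X (ω i)) x := by
    intro x
    rw [emp_cdf hn, Finset.sum_apply]
    simp only [hX, Finset.sum_sub_distrib, Finset.sum_const, Finset.card_univ, Fintype.card_fin,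
      nsmul_eq_mul]
    field_simp
  have hXi : ∀ i : Fin n, MemLp (fun ω : Fin n → ℝ => X (ω i)) 2 (Measure.pi fun _ => μ) := by
    intro i
    exact hXm.comp_measurePreserving (measurePreserving_eval (fun _ : Fin n => μ) i)
  have hS : MemLp (∑ i, fun ω : Fin n → ℝ => X (ω i)) 2 (Measure.pi fun _ => μ) :=
    memLp_finsetSum' _ fun i _ => hXi i
  have hvar := ProbabilityTheory.variance_sum_pi (μ := fun _ : Fin n => μ) (X := fun _ => X)
    (fun _ => hXm)
  have hmean : ∫ x, (∑ i, fun ω : Fin n → ℝ => X (ω i)) x ∂(Measure.pi fun _ => μ) = 0 := by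
    simp only [Finset.sum_apply]
    rw [integral_finsetSum _ (fun i _ => (hXi i).integrable (by norm_num))]
    apply Finset.sum_eq_zero
    intro i _
    rw [integral_comp_eval (μ := fun _ : Fin n => μ) (f := X) hXm.aestronglyMeasurable]
    exact ind_mean μ t
  rw [ProbabilityTheory.variance_of_integral_eq_zero hS.aestronglyMeasurable.aemeasurable hmean,
    ProbabilityTheory.variance_of_integral_eq_zero hXm.aestronglyMeasurable.aemeasurable
      (ind_mean μ t), ind_var] at hvar
  constructor
  · simp_rw [e, mul_pow]
    exact hS.integrable_sq.const_mul _
  · simp_rw [e, mul_pow]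
    rw [integral_const_mul, hvar]
    simp only [Finset.sum_const, Finset.card_univ, Fintype.card_fin, nsmul_eq_mul]
    field_simp

lemma emp_meas {n : ℕ} (hn : 0 < n) (μ : Measure ℝ) :
    Measurable (fun p : (Fin n → ℝ) × ℝ =>
      ENNReal.ofReal |ProbabilityTheory.cdf (emp p.1) p.2 - ProbabilityTheory.cdf μ p.2|) := by
  simp_rw [emp_cdf hn]
  have hc : Measurable (ProbabilityTheory.cdf μ) := (ProbabilityTheory.monotone_cdf μ).measurable
  have hi : ∀ i : Fin n, Measurable (fun p : (Fin n → ℝ) × ℝ =>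
      (Set.Iic p.2).indicator (fun _ => (1 : ℝ)) (p.1 i)) := by
    intro i
    have : (fun p : (Fin n → ℝ) × ℝ => (Set.Iic p.2).indicator (fun _ => (1 : ℝ)) (p.1 i))
        = {p : (Fin n → ℝ) × ℝ | p.1 i ≤ p.2}.indicator (fun _ => (1 : ℝ)) := by
      funext p
      by_cases h : p.1 i ≤ p.2
      · rw [Set.indicator_of_mem (show p.1 i ∈ Set.Iic p.2 from h), Set.indicator_of_mem (by exact h)]
      · rw [Set.indicator_of_notMem (show p.1 i ∉ Set.Iic p.2 from h),
          Set.indicator_of_notMem (by exact h)]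
    rw [this]
    refine measurable_const.indicator (measurableSet_le ?_ measurable_snd)
    fun_prop
  have h1 : Measurable (fun p : (Fin n → ℝ) × ℝ =>
      (n : ℝ)⁻¹ * ∑ i, (Set.Iic p.2).indicator (fun _ => (1 : ℝ)) (p.1 i)
        - ProbabilityTheory.cdf μ p.2) := by
    refine Measurable.sub (Measurable.const_mul (Finset.measurable_fun_sum _ fun i _ => hi i) _) ?_
    exact hc.comp measurable_snd
  exact ENNReal.measurable_ofReal.comp (continuous_abs.measurable.comp h1)

lemma emp_dist_meas {n : ℕ} (hn : 0 < n) (μ : Measure ℝ) :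
    Measurable (fun x : Fin n → ℝ => cdfDist (emp x) μ) :=
  (emp_meas hn μ).lintegral_prod_right'

lemma emp_abs {n : ℕ} (hn : 0 < n) (μ : Measure ℝ) [IsProbabilityMeasure μ] {s : ℝ} (hs : 0 < s)
    (hG : Integrable (fun y => Real.exp (s * |y|)) μ) (t : ℝ) :
    ∫⁻ x : Fin n → ℝ, ENNReal.ofReal |ProbabilityTheory.cdf (emp x) t - ProbabilityTheory.cdf μ t|
      ∂(Measure.pi fun _ => μ)
    ≤ ENNReal.ofReal ((((∫ y, Real.exp (s * |y|) ∂μ) + 1) / 2 / √n) * Real.exp (-(s / 2 * |t|))) := by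
  set C := ∫ y, Real.exp (s * |y|) ∂μ with hC
  obtain ⟨hi, he⟩ := emp_var hn μ t
  have hn' : (0 : ℝ) < n := by exact_mod_cast hn
  have hsn : 0 < √(n : ℝ) := Real.sqrt_pos.2 hn'
  set E := Real.exp (-(s / 2 * |t|)) with hE
  have hE0 : 0 < E := Real.exp_pos _
  have hE2 : Real.exp (-(s * |t|)) = E ^ 2 := by
    rw [hE, ← Real.exp_nat_mul]; congr 1; push_cast; ring
  set a := √(n : ℝ) / E with ha
  have ha0 : 0 < a := by positivity
  have hi2 : Integrable (fun x : Fin n → ℝ =>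
      (a * (ProbabilityTheory.cdf (emp x) t - ProbabilityTheory.cdf μ t) ^ 2 + a⁻¹) / 2)
      (Measure.pi fun _ => μ) := ((hi.const_mul a).add (integrable_const _)).div_const 2
  calc _ ≤ ∫⁻ x : Fin n → ℝ, ENNReal.ofReal
        ((a * (ProbabilityTheory.cdf (emp x) t - ProbabilityTheory.cdf μ t) ^ 2 + a⁻¹) / 2)
        ∂(Measure.pi fun _ => μ) := by
        apply lintegral_mono
        intro x
        apply ENNReal.ofReal_le_ofReal
        set y := ProbabilityTheory.cdf (emp x) t - ProbabilityTheory.cdf μ t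
        have h1 : (a * y ^ 2 + a⁻¹) / 2 - |y| = a⁻¹ * (a * |y| - 1) ^ 2 / 2 := by
          rw [← sq_abs y]; field_simp; ring
        have : 0 ≤ a⁻¹ * (a * |y| - 1) ^ 2 / 2 := by positivity
        linarith
    _ = ENNReal.ofReal (∫ x : Fin n → ℝ,
        ((a * (ProbabilityTheory.cdf (emp x) t - ProbabilityTheory.cdf μ t) ^ 2 + a⁻¹) / 2)
        ∂(Measure.pi fun _ => μ)) := by
        rw [ofReal_integral_eq_lintegral_ofReal hi2]
        exact Eventually.of_forall fun x => by
          simp only [Pi.zero_apply]; positivity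
    _ ≤ _ := by
        apply ENNReal.ofReal_le_ofReal
        rw [integral_div, integral_add (hi.const_mul a) (integrable_const _), integral_const_mul, he]
        have hv := cdf_var_bound μ hs hG t
        rw [hE2, ← hC] at hv
        simp only [integral_const, probReal_univ, smul_eq_mul, one_mul]
        have h1 : a * (ProbabilityTheory.cdf μ t * (1 - ProbabilityTheory.cdf μ t) / n)
            ≤ a * (C * E ^ 2 / n) := by gcongr
        have h2 : a * (C * E ^ 2 / n) = C / √n * E := by
          rw [ha]
          have : (n : ℝ) = √(n : ℝ) ^ 2 := (Real.sq_sqrt hn'.le).symm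
          rw [this, Real.sqrt_sq hsn.le]
          field_simp
        have h3 : a⁻¹ = E / √n := by rw [ha, inv_div]
        have h4 : (C + 1) / 2 / √n * E = (C / √n * E + E / √n) / 2 := by ring
        rw [h4, h3]
        linarith

lemma emp_bound {n : ℕ} (hn : 0 < n) (μ : Measure ℝ) [IsProbabilityMeasure μ] {s : ℝ} (hs : 0 < s)
    (hG : Integrable (fun y => Real.exp (s * |y|)) μ) :
    ∫⁻ x : Fin n → ℝ, cdfDist (emp x) μ ∂(Measure.pi fun _ => μ)
    ≤ ENNReal.ofReal ((((∫ y, Real.exp (s * |y|) ∂μ) + 1) / 2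
        * ∫ t, Real.exp (-(s / 2 * |t|))) / √n) := by
  unfold cdfDist
  rw [lintegral_lintegral_swap (emp_meas hn μ).aemeasurable]
  refine (lintegral_mono fun t => emp_abs hn μ hs hG t).trans ?_
  have hC : 0 ≤ ∫ y, Real.exp (s * |y|) ∂μ := integral_nonneg fun y => (Real.exp_pos _).le
  rw [← ofReal_integral_eq_lintegral_ofReal
    ((exp_abs_integrable (show 0 < s / 2 by positivity)).const_mul _)]
  · rw [integral_const_mul]
    apply ENNReal.ofReal_le_ofReal
    apply le_of_eq; ring
  · exact Eventually.of_forall fun t => by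
      simp only [Pi.zero_apply]; positivity

lemma max_bound {n : ℕ} (μ : Measure ℝ) [IsProbabilityMeasure μ] {s : ℝ} (hs : 0 < s)
    (hG : Integrable (fun y => Real.exp (s * |y|)) μ) (R : ℝ) :
    (Measure.pi fun _ : Fin n => μ) {x | ∃ i, R < |x i|}
      ≤ n * ENNReal.ofReal ((∫ y, Real.exp (s * |y|) ∂μ) * Real.exp (-(s * R))) := by
  have e : {x : Fin n → ℝ | ∃ i, R < |x i|} ⊆ ⋃ i, (Function.eval i) ⁻¹' {y : ℝ | R ≤ |y|} := by
    rintro x ⟨i, hi⟩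
    exact Set.mem_iUnion.2 ⟨i, hi.le⟩
  refine (measure_mono e).trans ((measure_iUnion_fintype_le _ _).trans ?_)
  have hm : MeasurableSet {y : ℝ | R ≤ |y|} := measurableSet_le measurable_const (by fun_prop)
  have h : ∀ i : Fin n, (Measure.pi fun _ : Fin n => μ) ((Function.eval i) ⁻¹' {y : ℝ | R ≤ |y|})
      ≤ ENNReal.ofReal ((∫ y, Real.exp (s * |y|) ∂μ) * Real.exp (-(s * R))) := by
    intro i
    rw [(measurePreserving_eval (fun _ : Fin n => μ) i).measure_preimage hm.nullMeasurableSet,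
      ← ofReal_measureReal]
    exact ENNReal.ofReal_le_ofReal (tail_bound μ hs hG R)
  refine (Finset.sum_le_sum fun i _ => h i).trans ?_
  simp


/-! ### Final assembly -/

lemma wass_det {n : ℕ} (hn : 0 < n) (x : Fin n → ℝ)
    (G G₀ : Measure ℝ) [IsProbabilityMeasure G] [IsProbabilityMeasure G₀]
    {s : ℝ} (hs : 0 < s) (hs1 : s < 1) (hG : Integrable (fun y => Real.exp (s * |y|)) G₀)
    (hM : ∀ G' : Measure ℝ, IsProbabilityMeasure G' →
      ∑ i : Fin n, Real.log (mixDens laplaceDens G' (x i)) ≤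
        ∑ i : Fin n, Real.log (mixDens laplaceDens G (x i)))
    {η l ε R : ℝ} (hη : 0 ≤ η) (hl : 0 < l) (hε : 0 < ε) (hR : 0 ≤ R)
    (hx : ∀ i, |x i| ≤ R) (hd : cdfDist (emp x) (lawOf G₀) ≤ ENNReal.ofReal η) :
    wassersteinDist 1 G G₀ ≤ 2 * R * (l * η + 2 / l) + 2 * (l * η + 2 / l) / ε + 2 * ε
      + ((∫ y, Real.exp (s * |y|) ∂G₀) * ∫ x, Real.exp (-(s / 2 * |x|)))
          * Real.exp (-(s / 2 * R)) := by
  have hfin : cdfDist (emp x) (lawOf G₀) ≠ ⊤ := (hd.trans_lt ENNReal.ofReal_lt_top).ne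
  have hD := likelihood_bound hn x G G₀ hs hs1 hG (hM G₀ inferInstance) hfin hl
  have hη' : (cdfDist (emp x) (lawOf G₀)).toReal ≤ η := ENNReal.toReal_le_of_le_ofReal hη hd
  have hD' : mixD G G₀ ≤ l * η + 2 / l := hD.trans (by gcongr)
  have hsupp := mle_support hn x hR hx G hM
  have h1 := deconv G G₀ hε hR
  have h2 := tail_cdfDist G G₀ hs hG hsupp
  set K := ((∫ y, Real.exp (s * |y|) ∂G₀) * ∫ x, Real.exp (-(s / 2 * |x|)))
          * Real.exp (-(s / 2 * R)) with hK
  have hK0 : 0 ≤ K := by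
    have a1 : 0 ≤ ∫ y, Real.exp (s * |y|) ∂G₀ := integral_nonneg fun y => (Real.exp_pos _).le
    have a2 : 0 ≤ ∫ x : ℝ, Real.exp (-(s / 2 * |x|)) := integral_nonneg fun y => (Real.exp_pos _).le
    positivity
  have hD0 := mixD_nonneg G G₀
  set D := l * η + 2 / l with hDd
  have hDp : 0 ≤ D := hD0.trans hD'
  have h3 : cdfDist G G₀ ≤ ENNReal.ofReal (2 * R * D + 2 * D / ε + 2 * ε + K) := by
    unfold cdfDist
    rw [← lintegral_add_compl _ (measurableSet_Icc (a := -R) (b := R)),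
      ENNReal.ofReal_add (by positivity) hK0]
    refine add_le_add (h1.trans (ENNReal.ofReal_le_ofReal ?_)) h2
    gcongr
  have hf2 : cdfDist G G₀ ≠ ⊤ := (h3.trans_lt ENNReal.ofReal_lt_top).ne
  exact (wass_le G G₀ hf2).trans (ENNReal.toReal_le_of_le_ofReal (by positivity) h3)

lemma log_rpow_small (c : ℝ) :
    ∀ᶠ n : ℕ in atTop, c * Real.log n * (n : ℝ) ^ (-(1 : ℝ) / 8) ≤ 1 := by
  have h := (isLittleO_log_rpow_atTop (show (0 : ℝ) < 1 / 8 by norm_num)).tendsto_div_nhds_zero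
  have h2 := (h.comp tendsto_natCast_atTop_atTop).const_mul c
  rw [mul_zero] at h2
  filter_upwards [h2.eventually_le_const (show (0 : ℝ) < 1 by norm_num)] with n hn
  refine le_trans (le_of_eq ?_) hn
  simp only [Function.comp]
  rw [show (-(1 : ℝ) / 8) = -(1 / 8) by ring, Real.rpow_neg (Nat.cast_nonneg _)]
  ring

lemma exp_log_nat {n : ℕ} (hn : 0 < n) {s : ℝ} (hs : 0 < s) :
    Real.exp (-(s * (4 / s * Real.log n))) = ((n : ℝ) ^ 4)⁻¹ ∧
    Real.exp (-(s / 2 * (4 / s * Real.log n))) = ((n : ℝ) ^ 2)⁻¹ := by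
  have hn' : (0 : ℝ) < n := by exact_mod_cast hn
  constructor
  · rw [Real.exp_neg, show s * (4 / s * Real.log n) = (4 : ℕ) * Real.log n by
      push_cast; field_simp, Real.exp_nat_mul, Real.exp_log hn']
  · rw [Real.exp_neg, show s / 2 * (4 / s * Real.log n) = (2 : ℕ) * Real.log n by
      push_cast; field_simp; norm_num, Real.exp_nat_mul, Real.exp_log hn']

lemma wass_event (G₀ : Measure ℝ) [IsProbabilityMeasure G₀]
    {s : ℝ} (hs : 0 < s) (hs1 : s < 1) (hG : Integrable (fun y => Real.exp (s * |y|)) G₀)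
    {A : ℝ} (hA : 0 < A) :
    ∀ᶠ n : ℕ in atTop, ∀ (x : Fin n → ℝ) (G : Measure ℝ), IsProbabilityMeasure G →
      (∀ G' : Measure ℝ, IsProbabilityMeasure G' →
      ∑ i : Fin n, Real.log (mixDens laplaceDens G' (x i)) ≤
        ∑ i : Fin n, Real.log (mixDens laplaceDens G (x i))) →
      (∀ i, |x i| ≤ 4 / s * Real.log n) →
      cdfDist (emp x) (lawOf G₀) ≤ ENNReal.ofReal (A / √n) →
      wassersteinDist 1 G G₀ ≤ (4 * A + 11) * wassRate n := by
  set K := (∫ y, Real.exp (s * |y|) ∂G₀) * ∫ x, Real.exp (-(s / 2 * |x|)) with hK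
  filter_upwards [log_rpow_small (4 / s), eventually_ge_atTop 3,
    tendsto_natCast_atTop_atTop.eventually_ge_atTop K] with n h1 h2 h3 x G hGp hM hx hd
  have hn : 0 < n := by omega
  have hn' : (0 : ℝ) < n := by exact_mod_cast hn
  have hn1 : (1 : ℝ) ≤ n := by exact_mod_cast hn
  have hn3 : (3 : ℝ) ≤ n := by exact_mod_cast h2
  have hlog : 1 ≤ Real.log n := by
    rw [Real.le_log_iff_exp_le hn']
    have := Real.exp_one_lt_d9
    linarith
  set R := 4 / s * Real.log n with hR
  have hR0 : 0 ≤ R := by positivity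
  set r := (n : ℝ) ^ (-(1 : ℝ) / 8) with hr
  have hr0 : 0 < r := Real.rpow_pos_of_pos hn' _
  have hr4 : (√n)⁻¹ = r ^ 4 := by
    rw [Real.sqrt_eq_rpow, ← Real.rpow_neg hn'.le, hr, ← Real.rpow_natCast, ← Real.rpow_mul hn'.le]
    norm_num
  have hmain := wass_det hn x G G₀ hs hs1 hG hM (η := A / √n) (l := (r ^ 2)⁻¹) (ε := r)
    (by positivity) (by positivity) hr0 hR0 hx hd
  rw [(exp_log_nat hn hs).2, ← hK, div_eq_mul_inv A, hr4] at hmain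
  have e1 : (r ^ 2)⁻¹ * (A * r ^ 4) + 2 / (r ^ 2)⁻¹ = (A + 2) * r ^ 2 := by
    field_simp
  rw [e1] at hmain
  have e2 : 2 * ((A + 2) * r ^ 2) / r = 2 * (A + 2) * r := by field_simp
  rw [e2] at hmain
  have hKr : K * ((n : ℝ) ^ 2)⁻¹ ≤ r := by
    calc K * ((n : ℝ) ^ 2)⁻¹ ≤ n * ((n : ℝ) ^ 2)⁻¹ := by gcongr
      _ = (n : ℝ) ^ (-1 : ℝ) := by rw [Real.rpow_neg_one]; field_simp
      _ ≤ r := Real.rpow_le_rpow_of_exponent_le hn1 (by norm_num)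
  have e3 : 2 * R * ((A + 2) * r ^ 2) ≤ 2 * (A + 2) * r := by
    calc 2 * R * ((A + 2) * r ^ 2) = 2 * (A + 2) * r * (R * r) := by ring
      _ ≤ 2 * (A + 2) * r * 1 := by gcongr
      _ = _ := by ring
  have h4 : r ≤ wassRate n := by
    unfold wassRate
    rw [← hr]
    exact le_mul_of_one_le_right hr0.le (Real.one_le_rpow hlog (by norm_num))
  calc wassersteinDist 1 G G₀ ≤ (4 * A + 11) * r := by linarith
    _ ≤ _ := by gcongr

lemma event_prob (G₀ : Measure ℝ) [IsProbabilityMeasure G₀]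
    {s : ℝ} (hs : 0 < s) (hs1 : s < 1) (hG : Integrable (fun y => Real.exp (s * |y|)) G₀) :
    ∃ K : ℝ, 0 ≤ K ∧ ∀ A : ℝ, 0 < A → ∀ n : ℕ, 0 < n →
      (Measure.pi fun _ : Fin n => lawOf G₀)
        ({x | ENNReal.ofReal (A / √n) ≤ cdfDist (emp x) (lawOf G₀)}
          ∪ {x | ∃ i, 4 / s * Real.log n < |x i|})
      ≤ ENNReal.ofReal (K / A) + ENNReal.ofReal (K / n) := by
  have hL := law_exp_moment G₀ hs hs1 hG
  set C := ∫ y, Real.exp (s * |y|) ∂(lawOf G₀) with hC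
  have hC0 : 0 ≤ C := integral_nonneg fun y => (Real.exp_pos _).le
  set I := ∫ t : ℝ, Real.exp (-(s / 2 * |t|)) with hI
  have hI0 : 0 ≤ I := integral_nonneg fun y => (Real.exp_pos _).le
  refine ⟨(C + 1) / 2 * I + C, by positivity, fun A hA n hn => ?_⟩
  have hn' : (0 : ℝ) < n := by exact_mod_cast hn
  have hn1 : (1 : ℝ) ≤ n := by exact_mod_cast hn
  have hsn : 0 < √(n : ℝ) := Real.sqrt_pos.2 hn'
  refine (measure_union_le _ _).trans (add_le_add ?_ ?_)
  · refine (meas_ge_le_lintegral_div (emp_dist_meas hn (lawOf G₀)).aemeasurable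
      (by simp only [ne_eq, ENNReal.ofReal_eq_zero, not_le]; positivity)
      ENNReal.ofReal_ne_top).trans ?_
    refine (ENNReal.div_le_div_right (emp_bound hn (lawOf G₀) hs hL) _).trans ?_
    rw [← ENNReal.ofReal_div_of_pos (by positivity)]
    apply ENNReal.ofReal_le_ofReal
    rw [← hC, ← hI, div_div_div_cancel_right₀ hsn.ne']
    gcongr
    linarith
  · refine (max_bound (lawOf G₀) hs hL _).trans ?_
    rw [(exp_log_nat hn hs).1, ← hC, ← ENNReal.ofReal_natCast, ← ENNReal.ofReal_mul hn'.le]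
    apply ENNReal.ofReal_le_ofReal
    have h1 : n * (C * ((n : ℝ) ^ 4)⁻¹) = C / (n ^ 3) := by field_simp
    rw [h1]
    have h2 : (n : ℝ) ≤ n ^ 3 := le_self_pow₀ hn1 (by norm_num)
    have h3 : 0 ≤ (C + 1) / 2 * I := by positivity
    gcongr
    linarith

theorem mle_main
    (G₀ : Measure ℝ) [hG₀ : IsProbabilityMeasure G₀]
    (Ghat : (n : ℕ) → (Fin n → ℝ) → Measure ℝ)
    (hGhat_prob : ∀ n x, IsProbabilityMeasure (Ghat n x))
    (hMLE : ∀ (n : ℕ) (x : Fin n → ℝ) (G : Measure ℝ), IsProbabilityMeasure G →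
      ∑ i : Fin n, Real.log (mixDens laplaceDens G (x i)) ≤
        ∑ i : Fin n, Real.log (mixDens laplaceDens (Ghat n x) (x i)))
    {s : ℝ} (hs : 0 < s) (hs1 : s < 1) (hG : Integrable (fun y => Real.exp (s * |y|)) G₀) :
    Tendsto
      (fun T : ℝ =>
        Filter.limsup
          (fun n : ℕ =>
            jointLaw (mixDens laplaceDens G₀) n
              {x : Fin n → ℝ | T * wassRate n <
                wassersteinDist 1 (Ghat n x) G₀})
          atTop)
      atTop (𝓝 (0 : ENNReal)) := by
  obtain ⟨K, hK0, hK⟩ := event_prob G₀ hs hs1 hG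
  have hlim : Tendsto (fun T : ℝ => ENNReal.ofReal (K / ((T - 11) / 4))) atTop (𝓝 0) := by
    have h1 : Tendsto (fun T : ℝ => K / ((T - 11) / 4)) atTop (𝓝 0) := by
      apply Tendsto.const_div_atTop
      exact (tendsto_atTop_add_const_right _ (-11) tendsto_id).atTop_div_const (by norm_num)
    have := ENNReal.tendsto_ofReal h1
    rwa [ENNReal.ofReal_zero] at this
  refine tendsto_of_tendsto_of_tendsto_of_le_of_le' tendsto_const_nhds hlim
    (Eventually.of_forall fun T => bot_le) ?_
  filter_upwards [eventually_gt_atTop (11 : ℝ)] with T hT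
  set A := (T - 11) / 4 with hA
  have hA0 : 0 < A := by rw [hA]; linarith
  have hTA : T = 4 * A + 11 := by rw [hA]; ring
  have hv : Tendsto (fun n : ℕ => ENNReal.ofReal (K / A) + ENNReal.ofReal (K / n)) atTop
      (𝓝 (ENNReal.ofReal (K / A))) := by
    have h1 : Tendsto (fun n : ℕ => K / (n : ℝ)) atTop (𝓝 0) :=
      tendsto_const_div_atTop_nhds_zero_nat K
    have h2 := (tendsto_const_nhds (x := ENNReal.ofReal (K / A))).add (ENNReal.tendsto_ofReal h1)
    rwa [ENNReal.ofReal_zero, add_zero] at h2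
  rw [← hv.limsup_eq]
  refine limsup_le_limsup ?_
  · filter_upwards [wass_event G₀ hs hs1 hG hA0, eventually_gt_atTop 0] with n h1 hn
    refine le_trans ?_ (hK A hA0 n hn)
    change (Measure.pi fun _ : Fin n => lawOf G₀) _ ≤ _
    apply measure_mono
    intro x hx
    by_contra hc
    simp only [Set.mem_union, not_or] at hc
    obtain ⟨hc1, hc2⟩ := hc
    have hc1' : cdfDist (emp x) (lawOf G₀) ≤ ENNReal.ofReal (A / √n) := (not_le.1 hc1).le
    have hc2' : ∀ i, |x i| ≤ 4 / s * Real.log n := fun i => by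
      by_contra hh
      exact hc2 ⟨i, not_le.1 hh⟩
    have := h1 x (Ghat n x) (hGhat_prob n x) (hMLE n x) hc2' hc1'
    rw [← hTA] at this
    exact absurd this (not_le.2 hx)

theorem mle_wasserstein_rate_laplace_deconvolution
    (G₀ : Measure ℝ) (hG₀ : IsProbabilityMeasure G₀)
    (σ : ℕ → ℝ) (hσ_nonneg : ∀ n, 0 ≤ σ n)
    (hσ_O : ∃ C : ℝ, ∀ᶠ n : ℕ in atTop, σ n ≤ C * mleRate n)
    (ha : ∃ C : ℝ, ∀ n : ℕ,
      ∫ x in {x : ℝ | mixDens laplaceDens G₀ x ≤ σ n},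
        mixDens laplaceDens G₀ x ≤ C * σ n ^ 2)
    (hb : ∃ C : ℝ, ∀ n : ℕ,
      ∫ x in {x : ℝ | σ n < mixDens laplaceDens G₀ x},
        (mixDens laplaceDens G₀ x)⁻¹ ≤ C * Real.log (1 / σ n))
    (Ghat : (n : ℕ) → (Fin n → ℝ) → Measure ℝ)
    (hGhat_prob : ∀ n x, IsProbabilityMeasure (Ghat n x))
    (hMLE : ∀ (n : ℕ) (x : Fin n → ℝ) (G : Measure ℝ), IsProbabilityMeasure G →
      ∑ i : Fin n, Real.log (mixDens laplaceDens G (x i)) ≤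
        ∑ i : Fin n, Real.log (mixDens laplaceDens (Ghat n x) (x i)))
    (s₀ : ℝ) (hs₀ : 0 < s₀) (hs₀1 : s₀ < 1)
    (hmgfG₀ : ∀ s : ℝ, |s| < s₀ → Integrable (fun y => Real.exp (s * y)) G₀)
    (hmgf_asymp : ∀ s : ℝ, 0 < s → s < s₀ →
      Filter.limsup (fun n : ℕ =>
          ∫ x, mgfOf (Ghat n x) (-s) ∂(jointLaw (mixDens laplaceDens G₀) n))
        atTop ≤ mgfOf G₀ (-s) ∧
      Filter.limsup (fun n : ℕ =>
          ∫ x, mgfOf (Ghat n x) s ∂(jointLaw (mixDens laplaceDens G₀) n))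
        atTop ≤ mgfOf G₀ s)
    (hmeas : ∀ n : ℕ, Measurable fun x : Fin n → ℝ =>
      wassersteinDist 1 (Ghat n x) G₀) :
    Tendsto
      (fun T : ℝ =>
        Filter.limsup
          (fun n : ℕ =>
            jointLaw (mixDens laplaceDens G₀) n
              {x : Fin n → ℝ | T * wassRate n <
                wassersteinDist 1 (Ghat n x) G₀})
          atTop)
      atTop (𝓝 (0 : ENNReal)) := by
  have hs : 0 < s₀ / 2 := by positivity
  have hG : Integrable (fun y => Real.exp (s₀ / 2 * |y|)) G₀ := by
    have h1 := hmgfG₀ (s₀ / 2) (by rw [abs_of_pos hs]; linarith)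
    have h2 := hmgfG₀ (-(s₀ / 2)) (by rw [abs_neg, abs_of_pos hs]; linarith)
    refine (h1.add h2).mono' (by fun_prop) (Eventually.of_forall fun y => ?_)
    rw [Real.norm_eq_abs, abs_of_pos (Real.exp_pos _), Pi.add_apply]
    have p1 := Real.exp_pos (s₀ / 2 * y)
    have p2 := Real.exp_pos (-(s₀ / 2) * y)
    rcases abs_cases y with ⟨h, _⟩ | ⟨h, _⟩
    · rw [h]; linarith
    · rw [h, mul_neg, ← neg_mul]; linarith
  exact mle_main G₀ Ghat hGhat_prob hMLE hs (by linarith) hG
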